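/- arXiv:1905.09138 — 6 statements merged into one kernel-verified Lean document; each statement's English description precedes it below -/
import Mathlib

section
/- Let d ≥ 1 and 0 < s < d. There exists a constant C(d,s) > 0, depending only on d and s, such that for every N, every bounded measurable set Ω ⊂ ℝ^d, and all points x_1,…,x_N ∈ ℝ^d, E^{d,s}_Jel(Ω; x_1,…,x_N) ≥ −C(d,s) N. -/
open MeasureTheory Real Set Classical
open scoped ENNReal BigOperators

noncomputable section

/-- `d`-dimensional Euclidean space. -/
abbrev Eu (d : ℕ) := EuclideanSpace ℝ (Fin d)

/-- The Riesz potential `V_s(r)`: `r^{-s}` for `s > 0`, `-log r` for `s = 0`,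
and `-r^{|s|}` for `s < 0`. -/
def rV (s r : ℝ) : ℝ := if 0 < s then r ^ (-s) else if s = 0 then -Real.log r else -(r ^ (-s))

/-- The Riesz potential as an extended real, equal to `+∞` at `r = 0` when `s ≥ 0`. -/
def rVE (s r : ℝ) : EReal := if r = 0 ∧ 0 ≤ s then ⊤ else ((rV s r : ℝ) : EReal)

/-- The Riesz Jellium energy `E^{d,s}_Jel(Ω; x₁,…,x_N)`, valued in the extended
reals (it equals `+∞` if two points coincide and `s ≥ 0`). -/
def rJel (d : ℕ) (s : ℝ) (Ω : Set (Eu d)) {N : ℕ} (X : Fin N → Eu d) : EReal :=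
  (∑ j : Fin N, ∑ k ∈ Finset.Ioi j, rVE s ‖X j - X k‖)
    - (((∑ j, ∫ y in Ω, rV s ‖X j - y‖) : ℝ) : EReal)
    + ((((1 : ℝ) / 2) * ∫ x in Ω, ∫ y in Ω, rV s ‖x - y‖ : ℝ) : EReal)

end

noncomputable section

/-- `t`-component of the representation of `r ^ (-s)` as a mixture of Gaussians in `r`. -/
def gaussianLayer (s t r : ℝ) : ℝ≥0∞ :=
  ENNReal.ofReal ((Real.Gamma (s / 2))⁻¹ * t ^ (s / 2 - 1) * Real.exp (-t * r ^ 2))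

theorem measurable_gaussianLayer (s : ℝ) :
    Measurable fun p : ℝ × ℝ => gaussianLayer s p.1 p.2 := by
  unfold gaussianLayer
  fun_prop

theorem lintegral_gaussianLayer {s r : ℝ} (hs : 0 < s) (hr : 0 < r) :
    ∫⁻ t in Ioi 0, gaussianLayer s t r = ENNReal.ofReal (r ^ (-s)) := by
  have hG : 0 < Real.Gamma (s / 2) := Real.Gamma_pos_of_pos (half_pos hs)
  have hr2 : 0 < r ^ 2 := by positivity
  have hint : IntegrableOn
      (fun t : ℝ => (Real.Gamma (s / 2))⁻¹ * t ^ (s / 2 - 1) * Real.exp (-t * r ^ 2)) (Ioi 0) := by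
    have h := (integrableOn_rpow_mul_exp_neg_mul_rpow (p := 1) (s := s / 2 - 1) (b := r ^ 2)
      (by linarith) one_pos hr2).const_mul (Real.Gamma (s / 2))⁻¹
    refine IntegrableOn.congr_fun h (fun t _ => ?_) measurableSet_Ioi
    simp only [Real.rpow_one, ← mul_assoc]
    congr 2
    ring
  unfold gaussianLayer
  rw [← ofReal_integral_eq_lintegral_ofReal hint]
  · congr 1
    have h := Real.integral_rpow_mul_exp_neg_mul_Ioi (half_pos hs) hr2
    calc _ = ∫ t in Ioi 0, (Real.Gamma (s / 2))⁻¹ *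
          (t ^ (s / 2 - 1) * Real.exp (-(r ^ 2 * t))) := by
          congr 1
          ext t
          rw [mul_assoc]
          congr 3
          ring
      _ = (1 / r ^ 2) ^ (s / 2) := by
          rw [integral_const_mul, h]
          field_simp
      _ = r ^ (-s) := by
          rw [one_div, Real.inv_rpow hr2.le, Real.rpow_neg hr.le, ← Real.rpow_natCast,
            ← Real.rpow_mul hr.le]
          congr 2
          push_cast
          ring
  · refine (ae_restrict_iff' measurableSet_Ioi).2 (.of_forall fun t ht => ?_)
    have : 0 < t := ht
    simp only [Pi.zero_apply]
    positivity

theorem lintegral_exp_neg_mul_norm_sub_sq {d : ℕ} {b : ℝ} (hb : 0 < b) (m : Eu d) :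
    ∫⁻ z, ENNReal.ofReal (Real.exp (-b * ‖m - z‖ ^ 2))
      = ENNReal.ofReal ((π / b) ^ ((d : ℝ) / 2)) := by
  rw [lintegral_sub_left_eq_self (fun z : Eu d => ENNReal.ofReal (Real.exp (-b * ‖z‖ ^ 2))) m]
  have h := GaussianFourier.integral_rexp_neg_mul_sq_norm (V := Eu d) hb
  rw [← ofReal_integral_eq_lintegral_ofReal, h]
  · simp
  · refine Integrable.of_integral_ne_zero ?_
    rw [h]
    positivity
  · exact .of_forall fun z => (Real.exp_pos _).le

theorem lintegral_gaussian_mul_gaussian {d : ℕ} {t : ℝ} (ht : 0 < t) (x y : Eu d) :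
    ENNReal.ofReal ((4 * t / π) ^ ((d : ℝ) / 2)) *
      ∫⁻ z, ENNReal.ofReal (Real.exp (-(2 * t) * ‖x - z‖ ^ 2)) *
        ENNReal.ofReal (Real.exp (-(2 * t) * ‖y - z‖ ^ 2))
      = ENNReal.ofReal (Real.exp (-t * ‖x - y‖ ^ 2)) := by
  have key : ∀ z : Eu d, ENNReal.ofReal (Real.exp (-(2 * t) * ‖x - z‖ ^ 2)) *
        ENNReal.ofReal (Real.exp (-(2 * t) * ‖y - z‖ ^ 2))
      = ENNReal.ofReal (Real.exp (-t * ‖x - y‖ ^ 2)) *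
        ENNReal.ofReal (Real.exp (-(4 * t) * ‖(1 / 2 : ℝ) • (x + y) - z‖ ^ 2)) := by
    intro z
    rw [← ENNReal.ofReal_mul (Real.exp_pos _).le, ← ENNReal.ofReal_mul (Real.exp_pos _).le,
      ← Real.exp_add, ← Real.exp_add]
    congr 2
    have h := parallelogram_law_with_norm ℝ (x - z) (y - z)
    have h1 : x - z + (y - z) = (2 : ℝ) • ((1 / 2 : ℝ) • (x + y) - z) := by module
    have h2 : x - z - (y - z) = x - y := by abel
    rw [h1, h2, norm_smul, Real.norm_of_nonneg zero_le_two] at h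
    linear_combination t * h
  simp_rw [key]
  rw [lintegral_const_mul _ (by fun_prop), lintegral_exp_neg_mul_norm_sub_sq (by positivity),
    mul_left_comm, ← ENNReal.ofReal_mul (by positivity),
    ← Real.mul_rpow (by positivity) (by positivity)]
  have : 4 * t / π * (π / (4 * t)) = 1 := by field_simp
  simp [this]

theorem ENNReal.two_mul_mul_le_add_sq (a b : ℝ≥0∞) : 2 * (a * b) ≤ a * a + b * b := by
  wlog h : a ≤ b generalizing a b
  · rw [mul_comm a b, add_comm]
    exact this b a (le_of_not_ge h)
  obtain ⟨c, rfl⟩ := exists_add_of_le h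
  calc 2 * (a * (a + c)) ≤ 2 * (a * (a + c)) + c * c := le_self_add
    _ = _ := by ring

/-- Positive definiteness of a kernel `∫ w(p) g(x,p) g(y,p) dρ(p)`, in a form free of
integrability assumptions. -/
theorem two_mul_lintegral_factored_kernel_le {α β : Type*} [MeasurableSpace α] [MeasurableSpace β]
    (μ ν : Measure α) (ρ : Measure β) [SFinite μ] [SFinite ν] [SFinite ρ]
    {w : β → ℝ≥0∞} {g : α → β → ℝ≥0∞} (hw : Measurable w) (hg : Measurable (Function.uncurry g)) :
    2 * ∫⁻ x, ∫⁻ y, ∫⁻ p, w p * (g x p * g y p) ∂ρ ∂ν ∂μ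
      ≤ (∫⁻ x, ∫⁻ y, ∫⁻ p, w p * (g x p * g y p) ∂ρ ∂μ ∂μ)
        + ∫⁻ x, ∫⁻ y, ∫⁻ p, w p * (g x p * g y p) ∂ρ ∂ν ∂ν := by
  have hgx : ∀ x, Measurable (g x) := fun x => hg.comp measurable_prodMk_left
  have hgp : ∀ p, Measurable fun x => g x p := fun p => hg.comp measurable_prodMk_right
  have hm : ∀ (κ : Measure α) [SFinite κ], Measurable fun p => ∫⁻ x, g x p ∂κ :=
    fun κ _ => (hg.comp measurable_swap).lintegral_prod_right'
  have swap : ∀ (κ κ' : Measure α) [SFinite κ] [SFinite κ'],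
      ∫⁻ x, ∫⁻ y, ∫⁻ p, w p * (g x p * g y p) ∂ρ ∂κ' ∂κ
        = ∫⁻ p, w p * ((∫⁻ x, g x p ∂κ) * ∫⁻ y, g y p ∂κ') ∂ρ := by
    intro κ κ' _ _
    have h1 : ∀ x, ∫⁻ y, ∫⁻ p, w p * (g x p * g y p) ∂ρ ∂κ'
        = ∫⁻ p, w p * (g x p * ∫⁻ y, g y p ∂κ') ∂ρ := by
      intro x
      rw [lintegral_lintegral_swap]
      · congr 1
        ext p
        rw [lintegral_const_mul _ ((hgp p).const_mul _), lintegral_const_mul _ (hgp p)]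
      · have := hgx x
        refine Measurable.aemeasurable ?_
        exact (hw.comp measurable_snd).mul ((this.comp measurable_snd).mul hg)
    simp_rw [h1]
    rw [lintegral_lintegral_swap]
    · congr 1
      ext p
      rw [lintegral_const_mul _ ((hgp p).mul_const _), lintegral_mul_const _ (hgp p)]
    · exact ((hw.comp measurable_snd).mul (hg.mul ((hm κ').comp measurable_snd))).aemeasurable
  have hm2 : ∀ (κ κ' : Measure α) [SFinite κ] [SFinite κ'],
      Measurable fun p => w p * ((∫⁻ x, g x p ∂κ) * ∫⁻ y, g y p ∂κ') :=
    fun κ κ' _ _ => hw.mul ((hm κ).mul (hm κ'))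
  rw [swap, swap, swap, ← lintegral_const_mul _ (hm2 μ ν), ← lintegral_add_left (hm2 μ μ)]
  refine lintegral_mono fun p => ?_
  dsimp only
  rw [← mul_add, mul_left_comm]
  gcongr
  exact ENNReal.two_mul_mul_le_add_sq _ _

/-- The part of the Riesz kernel made of the Gaussians of width at least `1`. -/
def longRange (s r : ℝ) : ℝ≥0∞ := ∫⁻ t in Ioc 0 1, gaussianLayer s t r

/-- The part of the Riesz kernel made of the Gaussians of width at most `1`. -/
def shortRange (s r : ℝ) : ℝ≥0∞ := ∫⁻ t in Ioi 1, gaussianLayer s t r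

theorem measurable_longRange (s : ℝ) : Measurable (longRange s) :=
  ((measurable_gaussianLayer s).comp measurable_swap).lintegral_prod_right'

theorem longRange_add_shortRange {s r : ℝ} (hs : 0 < s) (hr : 0 < r) :
    longRange s r + shortRange s r = ENNReal.ofReal (r ^ (-s)) := by
  rw [← lintegral_gaussianLayer hs hr, ← Ioc_union_Ioi_eq_Ioi zero_le_one,
    lintegral_union measurableSet_Ioi (Ioc_disjoint_Ioi le_rfl)]
  rfl

theorem longRange_le_zero {s : ℝ} (hs : 0 < s) (r : ℝ) : longRange s r ≤ longRange s 0 := by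
  have hG : 0 < Real.Gamma (s / 2) := Real.Gamma_pos_of_pos (half_pos hs)
  refine setLIntegral_mono' measurableSet_Ioc fun t ht => ENNReal.ofReal_le_ofReal ?_
  have : 0 < t := ht.1
  have h : -t * r ^ 2 ≤ -t * 0 ^ 2 := by nlinarith [mul_nonneg this.le (sq_nonneg r)]
  gcongr

theorem longRange_zero_lt_top {s : ℝ} (hs : 0 < s) : longRange s 0 < ⊤ := by
  have h : IntegrableOn (fun t : ℝ => t ^ (s / 2 - 1)) (Ioc 0 1) :=
    (intervalIntegrable_iff_integrableOn_Ioc_of_le zero_le_one).1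
      (intervalIntegral.intervalIntegrable_rpow' (by linarith))
  have := (h.const_mul (Real.Gamma (s / 2))⁻¹).lintegral_lt_top
  simpa [longRange, gaussianLayer] using this

theorem exists_lintegral_shortRange_le {d : ℕ} {s : ℝ} (hs : 0 < s) (hsd : s < d) :
    ∃ C : ℝ≥0∞, C < ⊤ ∧ ∀ x : Eu d, ∫⁻ y, shortRange s ‖x - y‖ ≤ C := by
  have hG : 0 < Real.Gamma (s / 2) := Real.Gamma_pos_of_pos (half_pos hs)
  have h : IntegrableOn (fun t : ℝ => t ^ (s / 2 - 1 - d / 2)) (Ioi 1) :=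
    integrableOn_Ioi_rpow_of_lt (by linarith) one_pos
  refine ⟨_, (h.const_mul ((Real.Gamma (s / 2))⁻¹ * π ^ ((d : ℝ) / 2))).lintegral_lt_top,
    fun x => ?_⟩
  unfold shortRange
  rw [lintegral_lintegral_swap]
  · refine (setLIntegral_congr_fun measurableSet_Ioi fun t ht => ?_).le
    have ht0 : 0 < t := one_pos.trans ht
    unfold gaussianLayer
    have h1 : ∀ y : Eu d, ENNReal.ofReal
        ((Real.Gamma (s / 2))⁻¹ * t ^ (s / 2 - 1) * Real.exp (-t * ‖x - y‖ ^ 2))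
        = ENNReal.ofReal ((Real.Gamma (s / 2))⁻¹ * t ^ (s / 2 - 1)) *
          ENNReal.ofReal (Real.exp (-t * ‖x - y‖ ^ 2)) :=
      fun y => ENNReal.ofReal_mul (by positivity)
    simp_rw [h1]
    rw [lintegral_const_mul _ (by fun_prop), lintegral_exp_neg_mul_norm_sub_sq ht0,
      ← ENNReal.ofReal_mul (by positivity)]
    congr 1
    rw [Real.div_rpow Real.pi_pos.le ht0.le, Real.rpow_sub ht0 (s / 2 - 1)]
    ring
  · exact ((measurable_gaussianLayer s).comp
      (measurable_snd.prodMk (measurable_const.sub measurable_fst).norm)).aemeasurable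

theorem two_mul_lintegral_longRange_le {d : ℕ} {s : ℝ} (hs : 0 < s) (μ ν : Measure (Eu d))
    [SFinite μ] [SFinite ν] :
    2 * ∫⁻ x, ∫⁻ y, longRange s ‖x - y‖ ∂ν ∂μ
      ≤ (∫⁻ x, ∫⁻ y, longRange s ‖x - y‖ ∂μ ∂μ) + ∫⁻ x, ∫⁻ y, longRange s ‖x - y‖ ∂ν ∂ν := by
  have hG : 0 < Real.Gamma (s / 2) := Real.Gamma_pos_of_pos (half_pos hs)
  let w : ℝ × Eu d → ℝ≥0∞ := fun p =>
    ENNReal.ofReal ((Real.Gamma (s / 2))⁻¹ * p.1 ^ (s / 2 - 1)) *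
      ENNReal.ofReal ((4 * p.1 / π) ^ ((d : ℝ) / 2))
  let g : Eu d → ℝ × Eu d → ℝ≥0∞ := fun x p =>
    ENNReal.ofReal (Real.exp (-(2 * p.1) * ‖x - p.2‖ ^ 2))
  have hw : Measurable w := by fun_prop
  have hg : Measurable (Function.uncurry g) := by
    unfold Function.uncurry g
    fun_prop
  have key : ∀ x y : Eu d, longRange s ‖x - y‖
      = ∫⁻ p, w p * (g x p * g y p) ∂((volume.restrict (Ioc (0 : ℝ) 1)).prod volume) := by
    intro x y
    rw [lintegral_prod _ (by fun_prop)]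
    refine setLIntegral_congr_fun measurableSet_Ioc fun t ht => ?_
    have ht0 : 0 < t := ht.1
    simp only [w, g]
    rw [lintegral_const_mul _ (by fun_prop), mul_assoc, lintegral_gaussian_mul_gaussian ht0,
      ← ENNReal.ofReal_mul (by positivity)]
    rfl
  simp_rw [key]
  exact two_mul_lintegral_factored_kernel_le μ ν _ hw hg

theorem rVE_eq_coe_ennreal {s r : ℝ} (hs : 0 < s) (hr : 0 ≤ r) :
    rVE s r = ((ENNReal.ofReal r ^ (-s) : ℝ≥0∞) : EReal) := by
  rcases hr.eq_or_lt with rfl | hr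
  · simp [rVE, hs.le, hs]
  · rw [ENNReal.ofReal_rpow_of_pos hr, EReal.coe_ennreal_ofReal,
      max_eq_left (by positivity)]
    simp [rVE, rV, hr.ne', hs]

theorem longRange_le_riesz {s r : ℝ} (hs : 0 < s) (hr : 0 ≤ r) :
    longRange s r ≤ ENNReal.ofReal r ^ (-s) := by
  rcases hr.eq_or_lt with rfl | hr
  · simp [hs]
  · rw [ENNReal.ofReal_rpow_of_pos hr, ← longRange_add_shortRange hs hr]
    exact le_self_add

theorem lintegral_riesz_le {d : ℕ} {s : ℝ} (hd : 1 ≤ d) (hs : 0 < s) {C : ℝ≥0∞}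
    (hC : ∀ x : Eu d, ∫⁻ y, shortRange s ‖x - y‖ ≤ C) (Ω : Set (Eu d)) (x : Eu d) :
    ∫⁻ y in Ω, ENNReal.ofReal (rV s ‖x - y‖) ≤ (∫⁻ y in Ω, longRange s ‖x - y‖) + C := by
  have : Nonempty (Fin d) := ⟨⟨0, hd⟩⟩
  have hne : ∀ᵐ y ∂(volume.restrict Ω), y ≠ x :=
    ae_restrict_of_ae (Measure.ae_ne volume x)
  calc _ = ∫⁻ y in Ω, (longRange s ‖x - y‖ + shortRange s ‖x - y‖) := by
        refine lintegral_congr_ae (hne.mono fun y hy => ?_)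
        dsimp only
        rw [longRange_add_shortRange hs (norm_pos_iff.2 (sub_ne_zero.2 hy.symm)), rV, if_pos hs]
    _ = (∫⁻ y in Ω, longRange s ‖x - y‖) + ∫⁻ y in Ω, shortRange s ‖x - y‖ :=
        lintegral_add_left ((measurable_longRange s).comp (by fun_prop)) _
    _ ≤ _ := by
        gcongr
        exact (setLIntegral_le_lintegral _ _).trans (hC x)

/-- Stability of Riesz Jellium, with all interaction terms as extended nonnegative reals. -/
theorem riesz_jellium_stability_ennreal {d : ℕ} {s : ℝ} (hd : 1 ≤ d) (hs : 0 < s) {C : ℝ≥0∞}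
    (hC : ∀ x : Eu d, ∫⁻ y, shortRange s ‖x - y‖ ≤ C) (Ω : Set (Eu d)) {N : ℕ}
    (X : Fin N → Eu d) :
    2 * ∑ j, ∫⁻ y in Ω, ENNReal.ofReal (rV s ‖X j - y‖)
      ≤ 2 * (∑ j : Fin N, ∑ k ∈ Finset.Ioi j, ENNReal.ofReal ‖X j - X k‖ ^ (-s))
        + (∫⁻ x in Ω, ∫⁻ y in Ω, ENNReal.ofReal (rV s ‖x - y‖))
        + N * (longRange s 0 + 2 * C) := by
  let μ : Measure (Eu d) := ∑ j, Measure.dirac (X j)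
  have hμ : ∀ f : Eu d → ℝ≥0∞, ∫⁻ x, f x ∂μ = ∑ j, f (X j) := by
    intro f
    simp [μ, lintegral_finsetSum_measure]
  have h1 := two_mul_lintegral_longRange_le hs μ (volume.restrict Ω)
  simp only [hμ] at h1
  have h2 : ∑ j, ∑ k, longRange s ‖X j - X k‖
      ≤ 2 * (∑ j : Fin N, ∑ k ∈ Finset.Ioi j, ENNReal.ofReal ‖X j - X k‖ ^ (-s))
        + N * longRange s 0 := by
    have hsplit : ∀ j : Fin N, ∑ k, longRange s ‖X j - X k‖
        = (∑ k ∈ {j}ᶜ, longRange s ‖X k - X j‖) + longRange s 0 := by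
      intro j
      rw [← Finset.sum_compl_add_sum {j}]
      simp [norm_sub_rev (X j)]
    simp_rw [hsplit]
    rw [Finset.sum_add_distrib,
      ← Finset.sum_sum_Ioi_add_eq_sum_sum_off_diag (fun i j => longRange s ‖X i - X j‖)]
    simp only [Finset.sum_const, Finset.card_univ, Fintype.card_fin, nsmul_eq_mul,
      Finset.mul_sum]
    gcongr with j _ k _
    rw [norm_sub_rev (X k), ← two_mul]
    gcongr
    exact longRange_le_riesz hs (norm_nonneg _)
  have h3 : ∫⁻ x in Ω, ∫⁻ y in Ω, longRange s ‖x - y‖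
      ≤ ∫⁻ x in Ω, ∫⁻ y in Ω, ENNReal.ofReal (rV s ‖x - y‖) := by
    have : Nonempty (Fin d) := ⟨⟨0, hd⟩⟩
    refine lintegral_mono fun x => lintegral_mono_ae ?_
    refine (ae_restrict_of_ae (Measure.ae_ne volume x)).mono fun y hy => ?_
    rw [rV, if_pos hs,
      ← longRange_add_shortRange hs (norm_pos_iff.2 (sub_ne_zero.2 hy.symm))]
    exact le_self_add
  calc 2 * ∑ j, ∫⁻ y in Ω, ENNReal.ofReal (rV s ‖X j - y‖)
      ≤ 2 * ∑ j, ((∫⁻ y in Ω, longRange s ‖X j - y‖) + C) := by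
        gcongr with j
        exact lintegral_riesz_le hd hs hC Ω (X j)
    _ = 2 * (∑ j, ∫⁻ y in Ω, longRange s ‖X j - y‖) + N * (2 * C) := by
        rw [Finset.sum_add_distrib]
        simp only [Finset.sum_const, Finset.card_univ, Fintype.card_fin, nsmul_eq_mul]
        ring
    _ ≤ _ := by
        grw [h1, h2, h3]
        exact le_of_eq (by ring)

theorem EReal.coe_ennreal_finsetSum {ι : Type*} (t : Finset ι) (f : ι → ℝ≥0∞) :
    ((∑ i ∈ t, f i : ℝ≥0∞) : EReal) = ∑ i ∈ t, (f i : EReal) :=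
  map_sum (⟨⟨(fun a : ℝ≥0∞ => (a : EReal)), EReal.coe_ennreal_zero⟩, EReal.coe_ennreal_add⟩ :
    ℝ≥0∞ →+ EReal) f t

/-- stability of Riesz Jellium. For `d ≥ 1` and `0 < s < d` there
is a constant `C(d,s) > 0` such that `E^{d,s}_Jel(Ω; x₁,…,x_N) ≥ -C(d,s) N` for all
`N`, all bounded measurable `Ω ⊂ ℝ^d` and all points `x₁,…,x_N`. -/
theorem statement8 (d : ℕ) (hd : 1 ≤ d) (s : ℝ) (hs : 0 < s) (hsd : s < d) :
    ∃ C : ℝ, 0 < C ∧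
      ∀ (N : ℕ) (Ω : Set (Eu d)), MeasurableSet Ω → Bornology.IsBounded Ω →
        ∀ X : Fin N → Eu d,
          ((-(C * N) : ℝ) : EReal) ≤ rJel d s Ω X := by
  obtain ⟨C, hCtop, hC⟩ := exists_lintegral_shortRange_le (d := d) hs hsd
  have hK := longRange_zero_lt_top hs
  have hDtop : longRange s 0 + 2 * C ≠ ⊤ := by finiteness
  set D := longRange s 0 + 2 * C with hD
  refine ⟨D.toReal + 1, by positivity, fun N Ω _ hb X => ?_⟩
  have hΩ : volume Ω < ⊤ := hb.measure_lt_top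
  have hVnn : ∀ r : ℝ, 0 ≤ r → 0 ≤ rV s r := fun r hr => by
    rw [rV, if_pos hs]
    positivity
  have hVm : Measurable fun p : Eu d × Eu d => rV s ‖p.1 - p.2‖ := by
    simp only [rV, if_pos hs]
    fun_prop
  have hsing_le : ∀ x : Eu d, ∫⁻ y in Ω, ENNReal.ofReal (rV s ‖x - y‖)
      ≤ longRange s 0 * volume Ω + C := by
    intro x
    refine (lintegral_riesz_le hd hs hC Ω x).trans ?_
    gcongr
    rw [← setLIntegral_const]
    exact lintegral_mono fun y => longRange_le_zero hs _
  have hMtop : longRange s 0 * volume Ω + C < ⊤ := by finiteness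
  have hsing : ∀ x : Eu d, ∫⁻ y in Ω, ENNReal.ofReal (rV s ‖x - y‖) ≠ ⊤ :=
    fun x => ((hsing_le x).trans_lt hMtop).ne
  have hdouble : ∫⁻ x in Ω, ∫⁻ y in Ω, ENNReal.ofReal (rV s ‖x - y‖) ≠ ⊤ := by
    refine ((lintegral_mono fun x => hsing_le x).trans_lt ?_).ne
    rw [setLIntegral_const]
    finiteness
  have hint : ∀ x : Eu d, ∫ y in Ω, rV s ‖x - y‖
      = (∫⁻ y in Ω, ENNReal.ofReal (rV s ‖x - y‖)).toReal := fun x =>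
    integral_eq_lintegral_of_nonneg_ae (.of_forall fun y => hVnn _ (norm_nonneg _))
      (hVm.comp measurable_prodMk_left).aestronglyMeasurable
  have hint2 : ∫ x in Ω, ∫ y in Ω, rV s ‖x - y‖
      = (∫⁻ x in Ω, ∫⁻ y in Ω, ENNReal.ofReal (rV s ‖x - y‖)).toReal := by
    simp_rw [hint]
    refine integral_toReal ?_ (.of_forall fun x => (hsing x).lt_top)
    exact hVm.ennreal_ofReal.lintegral_prod_right'.aemeasurable
  have main := riesz_jellium_stability_ennreal hd hs hC Ω X
  have hpair : (∑ j : Fin N, ∑ k ∈ Finset.Ioi j, rVE s ‖X j - X k‖)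
      = ((∑ j : Fin N, ∑ k ∈ Finset.Ioi j, ENNReal.ofReal ‖X j - X k‖ ^ (-s) : ℝ≥0∞) : EReal) := by
    simp only [EReal.coe_ennreal_finsetSum, rVE_eq_coe_ennreal hs (norm_nonneg _)]
  rw [rJel, hpair, hint2]
  simp only [hint]
  rw [← ENNReal.toReal_sum fun j _ => hsing (X j)]
  have hsum : ∑ j, ∫⁻ y in Ω, ENNReal.ofReal (rV s ‖X j - y‖) ≠ ⊤ :=
    ENNReal.sum_ne_top.2 fun j _ => hsing (X j)
  rw [← hD] at main
  generalize (∑ j : Fin N, ∑ k ∈ Finset.Ioi j, ENNReal.ofReal ‖X j - X k‖ ^ (-s)) = S at *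
  generalize ∑ j, ∫⁻ y in Ω, ENNReal.ofReal (rV s ‖X j - y‖) = A at *
  generalize ∫⁻ x in Ω, ∫⁻ y in Ω, ENNReal.ofReal (rV s ‖x - y‖) = B at *
  by_cases hS : S = ⊤
  · rw [hS, EReal.coe_ennreal_top, EReal.top_sub_coe, EReal.top_add_coe]
    exact le_top
  · rw [← EReal.coe_ennreal_toReal hS, ← EReal.coe_sub, ← EReal.coe_add, EReal.coe_le_coe_iff]
    have h := ENNReal.toReal_mono (by finiteness) main
    rw [ENNReal.toReal_add (by finiteness) (by finiteness),
      ENNReal.toReal_add (by finiteness) (by finiteness)] at h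
    simp only [ENNReal.toReal_mul, ENNReal.toReal_ofNat, ENNReal.toReal_natCast] at h
    have hN : (0 : ℝ) ≤ N := Nat.cast_nonneg N
    nlinarith [mul_nonneg hN (ENNReal.toReal_nonneg (a := D))]

end
end

section
/- Let d ≥ 1. There exists a constant C(d) > 0, depending only on d, such that for every positive integer N, every bounded measurable set Ω ⊂ ℝ^d with |Ω| = N, and all points x_1,…,x_N ∈ ℝ^d, the logarithmic Jellium energy satisfies −Σ_{1≤j<k≤N} log|x_j−x_k| + Σ_{j=1}^N ∫_Ω log|x_j−y| dy − (1/2) ∫_Ω∫_Ω log|x−y| dx dy ≥ −C(d) N. -/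
open MeasureTheory Real Set Classical
open scoped ENNReal BigOperators

noncomputable section

/-- `-log r`, interpreted as `+∞` at `r = 0` (coinciding points). -/
def negLogE (r : ℝ) : EReal := if r = 0 then ⊤ else ((-Real.log r : ℝ) : EReal)

/-- The contribution of the scales `t ≤ 1` to `2 log r`:
a conditionally negative definite function of the distance. -/
def logLong (r : ℝ) : ℝ := ∫ t in Ioc (0 : ℝ) 1, (1 - rexp (-t * r ^ 2)) / t

/-- The contribution of the scales `t > 1` to `-2 log r`: a nonnegative integrable function
of the distance. -/
def logShort (r : ℝ) : ℝ := ∫ t in Ioi (1 : ℝ), rexp (-t * r ^ 2) / t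

lemma logLong_zero : logLong 0 = 0 := by simp [logLong]

lemma logShort_nonneg (r : ℝ) : 0 ≤ logShort r :=
  setIntegral_nonneg measurableSet_Ioi fun _ ht =>
    div_nonneg (exp_pos _).le (zero_le_one.trans (le_of_lt ht))

lemma one_sub_exp_div_nonneg {t : ℝ} (ht : 0 < t) (s : ℝ) (hs : 0 ≤ s) :
    0 ≤ (1 - rexp (-t * s)) / t := by
  refine div_nonneg ?_ ht.le
  have : rexp (-t * s) ≤ 1 := exp_le_one_iff.2 (by nlinarith [mul_nonneg ht.le hs])
  linarith

lemma one_sub_exp_div_le {t : ℝ} (ht : 0 < t) (s : ℝ) :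
    (1 - rexp (-t * s)) / t ≤ s := by
  rw [div_le_iff₀ ht]
  linarith [add_one_le_exp (-t * s)]

lemma integrableOn_exp_neg_div {a : ℝ} (ha : 0 < a) :
    IntegrableOn (fun u : ℝ => rexp (-u) / u) (Ioi a) := by
  refine Integrable.mono' ((exp_neg_integrableOn_Ioi a one_pos).const_mul a⁻¹)
    (Measurable.aestronglyMeasurable (by fun_prop)) ?_
  filter_upwards [ae_restrict_mem measurableSet_Ioi] with u hu
  have hu' : a < u := hu
  rw [norm_of_nonneg (div_nonneg (exp_pos _).le (ha.trans hu').le), div_eq_inv_mul, neg_one_mul]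
  gcongr

lemma integrableOn_one_sub_exp_div {a : ℝ} :
    IntegrableOn (fun u : ℝ => (1 - rexp (-u)) / u) (Ioc 0 a) := by
  refine Measure.integrableOn_of_bounded (M := 1) (by simp)
    (Measurable.aestronglyMeasurable (by fun_prop)) ?_
  filter_upwards [ae_restrict_mem measurableSet_Ioc] with u hu
  have h1 := one_sub_exp_div_nonneg hu.1 1 zero_le_one
  have h2 := one_sub_exp_div_le hu.1 1
  rw [mul_one] at h1 h2
  rwa [norm_of_nonneg h1]

lemma logLong_eq {r : ℝ} (hr : 0 < r) :
    logLong r = ∫ u in (0 : ℝ)..r ^ 2, (1 - rexp (-u)) / u := by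
  have h := intervalIntegral.mul_integral_comp_mul_right (a := 0) (b := 1)
    (c := r ^ 2) (f := fun u : ℝ => (1 - rexp (-u)) / u)
  rw [zero_mul, one_mul, ← intervalIntegral.integral_const_mul] at h
  rw [← h, logLong, intervalIntegral.integral_of_le zero_le_one]
  refine setIntegral_congr_fun measurableSet_Ioc fun t ht => ?_
  have := ht.1.ne'
  simp only [neg_mul]
  field_simp

lemma logShort_eq {r : ℝ} (hr : 0 < r) :
    logShort r = ∫ u in Ioi (r ^ 2), rexp (-u) / u := by
  have h := integral_comp_mul_right_Ioi (fun u : ℝ => rexp (-u) / u) 1 (pow_pos hr 2)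
  rw [one_mul, eq_inv_smul_iff₀ (pow_pos hr 2).ne', smul_eq_mul, ← integral_const_mul] at h
  rw [← h, logShort]
  refine setIntegral_congr_fun measurableSet_Ioi fun t ht => ?_
  have : t ≠ 0 := (zero_lt_one.trans ht).ne'
  simp only [neg_mul]
  field_simp

lemma log_eq_logLong_sub_logShort {r : ℝ} (hr : 0 < r) :
    Real.log r = (logLong r - logShort r - (logLong 1 - logShort 1)) / 2 := by
  have ha : (0 : ℝ) < r ^ 2 := pow_pos hr 2
  rw [logLong_eq hr, logShort_eq hr, logLong_eq one_pos, logShort_eq one_pos, one_pow]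
  have hint : ∀ b : ℝ, 0 < b →
      IntervalIntegrable (fun u : ℝ => (1 - rexp (-u)) / u) volume 0 b := fun b hb =>
    (intervalIntegrable_iff_integrableOn_Ioc_of_le hb.le).2 integrableOn_one_sub_exp_div
  have hpos : ∀ u ∈ uIcc 1 (r ^ 2), 0 < u := fun u hu =>
    (lt_min one_pos ha).trans_le hu.1
  have hI : IntervalIntegrable (fun u : ℝ => rexp (-u) / u) volume 1 (r ^ 2) :=
    ContinuousOn.intervalIntegrable
      (ContinuousOn.div (by fun_prop) continuousOn_id fun u hu => (hpos u hu).ne')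
  have hJ : IntervalIntegrable (fun u : ℝ => 1 / u) volume 1 (r ^ 2) :=
    ContinuousOn.intervalIntegrable
      (ContinuousOn.div (by fun_prop) continuousOn_id fun u hu => (hpos u hu).ne')
  have h1 := intervalIntegral.integral_interval_sub_left (hint _ ha) (hint _ one_pos)
  have h2 := intervalIntegral.integral_Ioi_sub_Ioi' (integrableOn_exp_neg_div one_pos)
    (integrableOn_exp_neg_div ha)
  have h3 : ∫ u in (1 : ℝ)..r ^ 2, (1 - rexp (-u)) / u
      = (∫ u in (1 : ℝ)..r ^ 2, 1 / u) - ∫ u in (1 : ℝ)..r ^ 2, rexp (-u) / u := by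
    rw [← intervalIntegral.integral_sub hJ hI]
    simp only [sub_div]
  rw [integral_one_div_of_pos one_pos ha, div_one, Real.log_pow] at h3
  push_cast at h3
  linarith

lemma norm_logLong_le (r : ℝ) : ‖logLong r‖ ≤ r ^ 2 := by
  have h := norm_setIntegral_le_of_norm_le_const (μ := volume) (s := Ioc (0 : ℝ) 1)
    (f := fun t => (1 - rexp (-t * r ^ 2)) / t) (C := r ^ 2) (by simp) fun t ht => by
      rw [norm_of_nonneg (one_sub_exp_div_nonneg ht.1 _ (sq_nonneg r))]
      exact one_sub_exp_div_le ht.1 _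
  simpa [logLong] using h

lemma measurable_logLong : Measurable logLong := by
  have h : Measurable fun p : ℝ × ℝ => (1 - rexp (-p.2 * p.1 ^ 2)) / p.2 := by fun_prop
  exact (h.stronglyMeasurable.integral_prod_right' (ν := volume.restrict (Ioc 0 1))).measurable

lemma measurable_logShort : Measurable logShort := by
  have h : Measurable fun p : ℝ × ℝ => rexp (-p.2 * p.1 ^ 2) / p.2 := by fun_prop
  exact (h.stronglyMeasurable.integral_prod_right' (ν := volume.restrict (Ioi 1))).measurable

lemma exp_mul_exp_eq_midpoint {V : Type*} [NormedAddCommGroup V]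
    [InnerProductSpace ℝ V] (t : ℝ) (x y z : V) :
    rexp (-(2 * t) * ‖x - z‖ ^ 2) * rexp (-(2 * t) * ‖y - z‖ ^ 2)
      = rexp (-t * ‖x - y‖ ^ 2) * rexp (-(4 * t) * ‖z - (1 / 2 : ℝ) • (x + y)‖ ^ 2) := by
  rw [← exp_add, ← exp_add]
  congr 1
  have h := parallelogram_law_with_norm ℝ (x - z) (y - z)
  have h1 : x - z + (y - z) = (-2 : ℝ) • (z - (1 / 2 : ℝ) • (x + y)) := by module
  have h2 : x - z - (y - z) = x - y := by abel
  rw [h1, h2, norm_smul, mul_pow] at h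
  norm_num at h ⊢
  linear_combination t * h

lemma integral_exp_mul_exp_prod {V : Type*} [NormedAddCommGroup V] [MeasurableSpace V]
    {μ ν : Measure V} [SFinite μ] [SFinite ν] (t : ℝ) (z : V) :
    ∫ p : V × V, rexp (-(2 * t) * ‖p.1 - z‖ ^ 2) * rexp (-(2 * t) * ‖p.2 - z‖ ^ 2) ∂μ.prod ν
      = (∫ x, rexp (-(2 * t) * ‖x - z‖ ^ 2) ∂μ) * ∫ x, rexp (-(2 * t) * ‖x - z‖ ^ 2) ∂ν :=
  integral_prod_mul (fun x : V => rexp (-(2 * t) * ‖x - z‖ ^ 2))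
    (fun x : V => rexp (-(2 * t) * ‖x - z‖ ^ 2))

section InnerProduct

variable {V : Type*} [NormedAddCommGroup V] [InnerProductSpace ℝ V] [FiniteDimensional ℝ V]
  [MeasurableSpace V] [BorelSpace V]

lemma integrable_exp_neg_mul_norm_sq {b : ℝ} (hb : 0 < b) :
    Integrable fun v : V => rexp (-b * ‖v‖ ^ 2) := by
  refine Integrable.of_integral_ne_zero ?_
  rw [GaussianFourier.integral_rexp_neg_mul_sq_norm hb]
  positivity

lemma integrable_logShort_norm [Nontrivial V] : Integrable fun v : V => logShort ‖v‖ := by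
  have h : Integrable (fun p : V × ℝ => rexp (-p.2 * ‖p.1‖ ^ 2) / p.2)
      ((volume : Measure V).prod (volume.restrict (Ioi 1))) := by
    rw [integrable_prod_iff' (Measurable.aestronglyMeasurable (by fun_prop))]
    constructor
    · filter_upwards [ae_restrict_mem measurableSet_Ioi] with t ht
      exact (integrable_exp_neg_mul_norm_sq (zero_lt_one.trans ht)).div_const t
    · set n : ℝ := (Module.finrank ℝ V : ℝ) with hn_def
      have hn : 0 < n := by simpa [hn_def] using Module.finrank_pos (R := ℝ) (M := V)
      have hint : IntegrableOn (fun t : ℝ => π ^ (n / 2) * t ^ (-(n / 2) - 1)) (Ioi 1) :=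
        (integrableOn_Ioi_rpow_of_lt (by linarith) one_pos).const_mul _
      refine hint.congr_fun (fun t ht => ?_) measurableSet_Ioi
      have ht0 : (0 : ℝ) < t := zero_lt_one.trans ht
      have : ∀ v : V, ‖rexp (-t * ‖v‖ ^ 2) / t‖ = rexp (-t * ‖v‖ ^ 2) / t := fun v =>
        norm_of_nonneg (div_nonneg (exp_pos _).le ht0.le)
      simp only [this]
      rw [integral_div, GaussianFourier.integral_rexp_neg_mul_sq_norm ht0,
        div_rpow pi_pos.le ht0.le, rpow_sub ht0, rpow_neg ht0.le, rpow_one, ← hn_def]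
      field_simp
  exact h.integral_prod_left

lemma integrable_one_sub_exp_div_prod {μ ν : Measure V}
    (h : Integrable (fun p : V × V => ‖p.1 - p.2‖ ^ 2) (μ.prod ν)) :
    Integrable (fun q : (V × V) × ℝ => (1 - rexp (-q.2 * ‖q.1.1 - q.1.2‖ ^ 2)) / q.2)
      ((μ.prod ν).prod (volume.restrict (Ioc 0 1))) := by
  refine Integrable.mono' (h.comp_fst (volume.restrict (Ioc (0 : ℝ) 1)))
    (Measurable.aestronglyMeasurable (by fun_prop)) ?_
  have hmem : ∀ᵐ t ∂(volume.restrict (Ioc (0 : ℝ) 1)), t ∈ Ioc (0 : ℝ) 1 :=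
    ae_restrict_mem measurableSet_Ioc
  filter_upwards [Measure.quasiMeasurePreserving_snd.ae hmem] with q hq
  rw [norm_of_nonneg (one_sub_exp_div_nonneg hq.1 _ (sq_nonneg _))]
  exact one_sub_exp_div_le hq.1 _

lemma integrable_logLong {μ ν : Measure V}
    (h : Integrable (fun p : V × V => ‖p.1 - p.2‖ ^ 2) (μ.prod ν)) :
    Integrable (fun p : V × V => logLong ‖p.1 - p.2‖) (μ.prod ν) :=
  (integrable_one_sub_exp_div_prod h).integral_prod_left

variable {μ ν : Measure V} [IsFiniteMeasure μ] [IsFiniteMeasure ν]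

lemma integrable_exp_mul_exp {t : ℝ} (ht : 0 < t) :
    Integrable (fun q : (V × V) × V =>
      rexp (-(2 * t) * ‖q.1.1 - q.2‖ ^ 2) * rexp (-(2 * t) * ‖q.1.2 - q.2‖ ^ 2))
      ((μ.prod ν).prod volume) := by
  rw [integrable_prod_iff (by fun_prop)]
  simp only [exp_mul_exp_eq_midpoint, norm_mul, norm_of_nonneg (exp_pos _).le]
  constructor
  · exact .of_forall fun p => ((integrable_exp_neg_mul_norm_sq (by positivity)).comp_sub_right
      ((1 / 2 : ℝ) • (p.1 + p.2))).const_mul _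
  · simp only [integral_const_mul, integral_sub_right_eq_self (μ := (volume : Measure V))
      (fun v : V => rexp (-(4 * t) * ‖v‖ ^ 2))]
    refine Integrable.mul_const ?_ _
    refine Integrable.of_bound (by fun_prop) 1 (.of_forall fun p => ?_)
    rw [norm_of_nonneg (exp_pos _).le]
    exact exp_le_one_iff.2 (by nlinarith [mul_nonneg ht.le (sq_nonneg ‖p.1 - p.2‖)])

lemma integral_exp_mul_exp {t : ℝ} (ht : 0 < t) :
    (∫ p : V × V, rexp (-t * ‖p.1 - p.2‖ ^ 2) ∂μ.prod ν)
        * (∫ v : V, rexp (-(4 * t) * ‖v‖ ^ 2))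
      = ∫ z : V, (∫ x, rexp (-(2 * t) * ‖x - z‖ ^ 2) ∂μ)
          * ∫ x, rexp (-(2 * t) * ‖x - z‖ ^ 2) ∂ν := by
  have h := integral_integral_swap (f := fun (p : V × V) (z : V) =>
    rexp (-(2 * t) * ‖p.1 - z‖ ^ 2) * rexp (-(2 * t) * ‖p.2 - z‖ ^ 2))
    (integrable_exp_mul_exp (μ := μ) (ν := ν) ht)
  simp only [integral_exp_mul_exp_prod] at h
  rw [← h, ← integral_mul_const]
  congr 1 with p
  simp only [exp_mul_exp_eq_midpoint, integral_const_mul,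
    integral_sub_right_eq_self (μ := (volume : Measure V))
      (fun v : V => rexp (-(4 * t) * ‖v‖ ^ 2))]

lemma integrable_integral_exp_mul {t : ℝ} (ht : 0 < t) :
    Integrable (fun z : V => (∫ x, rexp (-(2 * t) * ‖x - z‖ ^ 2) ∂μ)
          * ∫ x, rexp (-(2 * t) * ‖x - z‖ ^ 2) ∂ν) := by
  have h := (integrable_exp_mul_exp (μ := μ) (ν := ν) ht).integral_prod_right
  simpa only [integral_exp_mul_exp_prod] using h

/-- Positive definiteness of the Gaussian kernel, tested on the signed measure `μ - ν`. -/
lemma two_mul_integral_exp_le {t : ℝ} (ht : 0 < t) :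
    2 * ∫ p : V × V, rexp (-t * ‖p.1 - p.2‖ ^ 2) ∂μ.prod ν ≤
      (∫ p : V × V, rexp (-t * ‖p.1 - p.2‖ ^ 2) ∂μ.prod μ)
        + ∫ p : V × V, rexp (-t * ‖p.1 - p.2‖ ^ 2) ∂ν.prod ν := by
  have hG : 0 < ∫ v : V, rexp (-(4 * t) * ‖v‖ ^ 2) := by
    rw [GaussianFourier.integral_rexp_neg_mul_sq_norm (by positivity)]
    positivity
  refine le_of_mul_le_mul_right ?_ hG
  rw [add_mul, mul_assoc, integral_exp_mul_exp ht, integral_exp_mul_exp ht,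
    integral_exp_mul_exp ht, ← integral_add (integrable_integral_exp_mul ht)
    (integrable_integral_exp_mul ht), ← integral_const_mul]
  refine integral_mono ((integrable_integral_exp_mul ht).const_mul _)
    ((integrable_integral_exp_mul ht).add (integrable_integral_exp_mul ht)) fun z => ?_
  simp only
  nlinarith [sq_nonneg ((∫ x, rexp (-(2 * t) * ‖x - z‖ ^ 2) ∂μ)
    - ∫ x, rexp (-(2 * t) * ‖x - z‖ ^ 2) ∂ν)]

lemma integral_one_sub_exp_div (t : ℝ) (ht : 0 < t) :
    ∫ p : V × V, (1 - rexp (-t * ‖p.1 - p.2‖ ^ 2)) / t ∂μ.prod ν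
      = (μ.real univ * ν.real univ
        - ∫ p : V × V, rexp (-t * ‖p.1 - p.2‖ ^ 2) ∂μ.prod ν) / t := by
  have hi : Integrable (fun p : V × V => rexp (-t * ‖p.1 - p.2‖ ^ 2)) (μ.prod ν) := by
    refine Integrable.of_bound (by fun_prop) 1 (.of_forall fun p => ?_)
    rw [norm_of_nonneg (exp_pos _).le]
    exact exp_le_one_iff.2 (by nlinarith [mul_nonneg ht.le (sq_nonneg ‖p.1 - p.2‖)])
  rw [integral_div, integral_sub (integrable_const _) hi]
  simp [← univ_prod_univ, measureReal_prod_prod]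

/-- The kernel `logLong` is conditionally negative definite, tested on the neutral signed
measure `μ - ν`. -/
lemma integral_logLong_add_le (hmass : μ.real univ = ν.real univ)
    (hμν : Integrable (fun p : V × V => ‖p.1 - p.2‖ ^ 2) (μ.prod ν))
    (hμ : Integrable (fun p : V × V => ‖p.1 - p.2‖ ^ 2) (μ.prod μ))
    (hν : Integrable (fun p : V × V => ‖p.1 - p.2‖ ^ 2) (ν.prod ν)) :
    (∫ p : V × V, logLong ‖p.1 - p.2‖ ∂μ.prod μ) + ∫ p : V × V, logLong ‖p.1 - p.2‖ ∂ν.prod ν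
      ≤ 2 * ∫ p : V × V, logLong ‖p.1 - p.2‖ ∂μ.prod ν := by
  have swap : ∀ (α β : Measure V) [IsFiniteMeasure α] [IsFiniteMeasure β],
      Integrable (fun p : V × V => ‖p.1 - p.2‖ ^ 2) (α.prod β) →
      ∫ p : V × V, logLong ‖p.1 - p.2‖ ∂α.prod β = ∫ t in Ioc (0 : ℝ) 1,
        ∫ p : V × V, (1 - rexp (-t * ‖p.1 - p.2‖ ^ 2)) / t ∂α.prod β := fun α β _ _ h =>
    integral_integral_swap (f := fun (p : V × V) (t : ℝ) =>
      (1 - rexp (-t * ‖p.1 - p.2‖ ^ 2)) / t) (integrable_one_sub_exp_div_prod h)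
  have hint : ∀ (α β : Measure V) [IsFiniteMeasure α] [IsFiniteMeasure β],
      Integrable (fun p : V × V => ‖p.1 - p.2‖ ^ 2) (α.prod β) →
      IntegrableOn (fun t : ℝ => ∫ p : V × V, (1 - rexp (-t * ‖p.1 - p.2‖ ^ 2)) / t ∂α.prod β)
        (Ioc 0 1) := fun α β _ _ h => (integrable_one_sub_exp_div_prod h).integral_prod_right
  rw [swap μ ν hμν, swap μ μ hμ, swap ν ν hν, ← integral_const_mul,
    ← integral_add (hint μ μ hμ) (hint ν ν hν)]
  refine setIntegral_mono_on ((hint μ μ hμ).add (hint ν ν hν)) ((hint μ ν hμν).const_mul 2)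
    measurableSet_Ioc fun t ht => ?_
  simp only [integral_one_sub_exp_div t ht.1]
  rw [← add_div, ← mul_div_assoc, hmass]
  have := two_mul_integral_exp_le (μ := μ) (ν := ν) ht.1
  refine div_le_div_of_nonneg_right ?_ ht.1.le
  linarith

lemma integrable_norm_sub_sq {R : ℝ} (hμ : ∀ᵐ x ∂μ, ‖x‖ ≤ R) (hν : ∀ᵐ x ∂ν, ‖x‖ ≤ R) :
    Integrable (fun p : V × V => ‖p.1 - p.2‖ ^ 2) (μ.prod ν) := by
  refine Integrable.of_bound (by fun_prop) ((R + R) ^ 2) ?_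
  filter_upwards [Measure.quasiMeasurePreserving_fst.ae hμ,
    Measure.quasiMeasurePreserving_snd.ae hν] with p h1 h2
  rw [norm_of_nonneg (sq_nonneg _)]
  gcongr
  exact (norm_sub_le _ _).trans (add_le_add h1 h2)

end InnerProduct

section SetIntegral

variable {V : Type*} [NormedAddCommGroup V] [InnerProductSpace ℝ V] [FiniteDimensional ℝ V]
  [MeasurableSpace V] [BorelSpace V] {Ω : Set V}

lemma integrableOn_logLong_norm_sub (hb : Bornology.IsBounded Ω) (hm : MeasurableSet Ω) (x : V) :
    IntegrableOn (fun y => logLong ‖x - y‖) Ω := by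
  obtain ⟨R, hR⟩ := hb.exists_norm_le
  refine Measure.integrableOn_of_bounded (M := (‖x‖ + R) ^ 2) hb.measure_lt_top.ne
    (measurable_logLong.comp (by fun_prop)).aestronglyMeasurable ?_
  filter_upwards [ae_restrict_mem hm] with y hy
  refine (norm_logLong_le _).trans ?_
  gcongr
  exact (norm_sub_le _ _).trans (by gcongr; exact hR y hy)

lemma setIntegral_logShort_nonneg (x : V) : 0 ≤ ∫ y in Ω, logShort ‖x - y‖ :=
  integral_nonneg fun _ => logShort_nonneg _

variable [Nontrivial V]

lemma integrable_logShort_norm_sub (x : V) : Integrable fun y : V => logShort ‖x - y‖ :=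
  integrable_logShort_norm.comp_sub_left x

lemma setIntegral_logShort_le (x : V) :
    ∫ y in Ω, logShort ‖x - y‖ ≤ ∫ v : V, logShort ‖v‖ := by
  rw [← integral_sub_left_eq_self (fun v : V => logShort ‖v‖) volume x]
  exact setIntegral_le_integral (integrable_logShort_norm_sub x)
    (.of_forall fun _ => logShort_nonneg _)

lemma integrableOn_setIntegral_logShort (hb : Bornology.IsBounded Ω) :
    IntegrableOn (fun x => ∫ y in Ω, logShort ‖x - y‖) Ω := by
  have h : Measurable fun p : V × V => logShort ‖p.1 - p.2‖ :=
    measurable_logShort.comp (by fun_prop)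
  refine Measure.integrableOn_of_bounded (M := ∫ v : V, logShort ‖v‖) hb.measure_lt_top.ne
    h.stronglyMeasurable.integral_prod_right'.aestronglyMeasurable (.of_forall fun x => ?_)
  rw [norm_of_nonneg (setIntegral_logShort_nonneg x)]
  exact setIntegral_logShort_le x

lemma setIntegral_log_norm_sub (hb : Bornology.IsBounded Ω) (hm : MeasurableSet Ω) (x : V) :
    ∫ y in Ω, Real.log ‖x - y‖ = ((∫ y in Ω, logLong ‖x - y‖) - (∫ y in Ω, logShort ‖x - y‖)
      - (logLong 1 - logShort 1) * volume.real Ω) / 2 := by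
  have h : ∀ᵐ y ∂(volume.restrict Ω), Real.log ‖x - y‖
      = (logLong ‖x - y‖ - logShort ‖x - y‖ - (logLong 1 - logShort 1)) / 2 := by
    filter_upwards [ae_restrict_of_ae (compl_mem_ae_iff.2 (measure_singleton x))] with y hy
    exact log_eq_logLong_sub_logShort (norm_pos_iff.2 (sub_ne_zero.2 (Ne.symm hy)))
  have h1 := integrableOn_logLong_norm_sub hb hm x
  have h2 := (integrable_logShort_norm_sub x).integrableOn (s := Ω)
  have h12 : IntegrableOn (fun y => logLong ‖x - y‖ - logShort ‖x - y‖) Ω := h1.sub h2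
  have h3 : IntegrableOn (fun _ : V => logLong 1 - logShort 1) Ω :=
    integrableOn_const hb.measure_lt_top.ne
  rw [integral_congr_ae h, integral_div, integral_sub h12 h3, integral_sub h1 h2]
  simp [mul_comm]

end SetIntegral

section PointConfiguration

variable {V : Type*} [NormedAddCommGroup V] [InnerProductSpace ℝ V] [FiniteDimensional ℝ V]
  [MeasurableSpace V] [BorelSpace V] {Ω : Set V} {N : ℕ} (X : Fin N → V)

lemma sum_logLong_add_le (hb : Bornology.IsBounded Ω) (hm : MeasurableSet Ω)
    (hvol : volume.real Ω = N) :
    (∑ j, ∑ k, logLong ‖X j - X k‖) + (∫ x in Ω, ∫ y in Ω, logLong ‖x - y‖)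
      ≤ 2 * ∑ j, ∫ y in Ω, logLong ‖X j - y‖ := by
  obtain ⟨μ, hμ_def⟩ : ∃ μ : Measure V, μ = Measure.count.map X := ⟨_, rfl⟩
  have hX : Measurable X := measurable_of_finite X
  have : IsFiniteMeasure (volume.restrict Ω) := ⟨by simpa using hb.measure_lt_top⟩
  have : IsFiniteMeasure μ := hμ_def ▸ inferInstance
  have hsum : ∀ f : V → ℝ, Measurable f → ∫ x, f x ∂μ = ∑ j, f (X j) := fun f hf => by
    rw [hμ_def, integral_map hX.aemeasurable hf.aestronglyMeasurable, integral_count]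
  obtain ⟨R, hR⟩ := (hb.union (finite_range X).isBounded).exists_norm_le
  have hRμ : ∀ᵐ x ∂μ, ‖x‖ ≤ R := by
    rw [hμ_def, ae_map_iff hX.aemeasurable (measurableSet_le measurable_norm measurable_const)]
    exact .of_forall fun j => hR (X j) (mem_union_right _ (mem_range_self j))
  have hRν : ∀ᵐ x ∂(volume.restrict Ω), ‖x‖ ≤ R := by
    filter_upwards [ae_restrict_mem hm] with x hx using hR x (mem_union_left _ hx)
  have hmass : μ.real univ = (volume.restrict Ω).real univ := by
    simp [hμ_def, hvol, map_measureReal_apply hX MeasurableSet.univ,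
      measureReal_def Measure.count]
  have h := integral_logLong_add_le hmass (integrable_norm_sub_sq hRμ hRν)
    (integrable_norm_sub_sq hRμ hRμ) (integrable_norm_sub_sq hRν hRν)
  have hmeas : Measurable fun p : V × V => logLong ‖p.1 - p.2‖ :=
    measurable_logLong.comp (by fun_prop)
  have hpar : ∀ (α : Measure V) [IsFiniteMeasure α],
      Measurable fun x => ∫ y, logLong ‖x - y‖ ∂α := fun α _ =>
    (hmeas.stronglyMeasurable.integral_prod_right' (ν := α)).measurable
  rw [integral_prod _ (integrable_logLong (integrable_norm_sub_sq hRμ hRν)),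
    integral_prod _ (integrable_logLong (integrable_norm_sub_sq hRμ hRμ)),
    integral_prod _ (integrable_logLong (integrable_norm_sub_sq hRν hRν)),
    hsum _ (hpar _), hsum _ (hpar _)] at h
  have hsum' : ∀ x, ∫ y, logLong ‖x - y‖ ∂μ = ∑ k, logLong ‖x - X k‖ := fun x =>
    hsum (fun y => logLong ‖x - y‖) (measurable_logLong.comp (by fun_prop))
  simpa only [hsum'] using h

end PointConfiguration

lemma le_negLogE {r : ℝ} (hr : 0 ≤ r) :
    (((logLong 1 - logShort 1 - logLong r) / 2 : ℝ) : EReal) ≤ negLogE r := by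
  unfold negLogE
  split_ifs with h
  · exact le_top
  · rw [log_eq_logLong_sub_logShort (hr.lt_of_ne' h), EReal.coe_le_coe_iff]
    linarith [logShort_nonneg r]

lemma sum_Ioi_eq_sum_div_two {N : ℕ} (f : Fin N → Fin N → ℝ) (hsymm : ∀ j k, f j k = f k j)
    (hdiag : ∀ j, f j j = 0) :
    ∑ j, ∑ k ∈ Finset.Ioi j, f j k = (∑ j, ∑ k, f j k) / 2 := by
  have h1 : ∀ j k, f j k = (if j < k then f j k else 0) + if k < j then f k j else 0 := by
    intro j k
    rcases lt_trichotomy j k with h | rfl | h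
    · simp [h, h.not_gt]
    · simp [hdiag]
    · simp [h, h.not_gt, hsymm j k]
  have h2 : ∑ j, ∑ k ∈ Finset.Ioi j, f j k = ∑ j, ∑ k, if j < k then f j k else 0 := by
    refine Finset.sum_congr rfl fun j _ => ?_
    rw [← Finset.sum_filter]
    congr 1
    ext k
    simp
  have h3 : ∑ j, ∑ k, f j k = (∑ j, ∑ k, if j < k then f j k else 0)
      + ∑ j, ∑ k, if k < j then f k j else 0 := by
    simp_rw [← Finset.sum_add_distrib]
    exact Finset.sum_congr rfl fun j _ => Finset.sum_congr rfl fun k _ => h1 j k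
  rw [Finset.sum_comm (f := fun j k => if k < j then f k j else 0)] at h3
  linarith

/-- stability of the logarithmic Jellium. For each `d ≥ 1` there
is `C(d) > 0` such that for every `N`, every bounded measurable `Ω ⊂ ℝ^d` with
`|Ω| = N`, and all points `x₁,…,x_N`,
`-Σ_{j<k} log|x_j-x_k| + Σ_j ∫_Ω log|x_j-y| dy - ½ ∬_Ω log|x-y| dx dy ≥ -C(d) N`. -/
theorem statement9 (d : ℕ) (hd : 1 ≤ d) :
    ∃ C : ℝ, 0 < C ∧
      ∀ (N : ℕ), 0 < N →
        ∀ (Ω : Set (Eu d)), MeasurableSet Ω → Bornology.IsBounded Ω →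
          volume Ω = N →
          ∀ X : Fin N → Eu d,
            ((-(C * N) : ℝ) : EReal) ≤
              (∑ j : Fin N, ∑ k ∈ Finset.Ioi j, negLogE ‖X j - X k‖)
                + (((∑ j, ∫ y in Ω, Real.log ‖X j - y‖) : ℝ) : EReal)
                - ((((1 : ℝ) / 2) * ∫ x in Ω, ∫ y in Ω, Real.log ‖x - y‖ : ℝ) : EReal) := by
  have : Nonempty (Fin d) := ⟨⟨0, hd⟩⟩
  have : Nontrivial (Eu d) := inferInstance
  set c : ℝ := logLong 1 - logShort 1 with hc
  set K : ℝ := ∫ v : Eu d, logShort ‖v‖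
  have hK0 : 0 ≤ K := integral_nonneg fun v => logShort_nonneg _
  refine ⟨|c| / 4 + K / 2 + 1, by positivity, fun N hN Ω hm hb hvol X => ?_⟩
  have hvol' : volume.real Ω = N := by simp [measureReal_def, hvol]
  have hpair : ((∑ j : Fin N, ∑ k ∈ Finset.Ioi j, (c - logLong ‖X j - X k‖) / 2 : ℝ) : EReal)
      ≤ ∑ j : Fin N, ∑ k ∈ Finset.Ioi j, negLogE ‖X j - X k‖ := by
    have hcoe : ∀ (s : Finset (Fin N)) (f : Fin N → ℝ),
        ((∑ i ∈ s, f i : ℝ) : EReal) = ∑ i ∈ s, (f i : EReal) := fun s f =>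
      map_sum (⟨⟨Real.toEReal, EReal.coe_zero⟩, EReal.coe_add⟩ : ℝ →+ EReal) f s
    simp only [hcoe]
    exact Finset.sum_le_sum fun j _ => Finset.sum_le_sum fun k _ =>
      le_negLogE (norm_nonneg (X j - X k))
  refine le_trans ?_ (EReal.sub_le_sub (add_le_add_left hpair _) le_rfl)
  rw [← EReal.coe_add, ← EReal.coe_sub, EReal.coe_le_coe_iff]
  have hpairs : ∑ j : Fin N, ∑ k ∈ Finset.Ioi j, (c - logLong ‖X j - X k‖) / 2
      = c * (N * (N - 1)) / 4 - (∑ j, ∑ k, logLong ‖X j - X k‖) / 4 := by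
    have h1 := sum_Ioi_eq_sum_div_two (fun j k => logLong ‖X j - X k‖)
      (fun j k => congrArg logLong (norm_sub_rev (X j) (X k))) (fun j => by simp [logLong_zero])
    have h2 := sum_Ioi_eq_sum_div_two (fun j k : Fin N => if j = k then (0 : ℝ) else 1)
      (fun j k => by simp [eq_comm]) (fun j => by simp)
    have h3 : ∑ j : Fin N, ∑ k : Fin N, (if j = k then (0 : ℝ) else 1) = N * (N - 1) := by
      have : ∀ j k : Fin N, (if j = k then (0 : ℝ) else 1) = 1 - if j = k then 1 else 0 := by
        intro j k; split_ifs <;> simp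
      simp [this]
      ring
    have h4 : ∑ j : Fin N, ∑ k ∈ Finset.Ioi j, (c - logLong ‖X j - X k‖) / 2
        = c / 2 * (∑ j : Fin N, ∑ k ∈ Finset.Ioi j, if j = k then (0 : ℝ) else 1)
          - (∑ j : Fin N, ∑ k ∈ Finset.Ioi j, logLong ‖X j - X k‖) / 2 := by
      simp_rw [Finset.mul_sum, Finset.sum_div, ← Finset.sum_sub_distrib]
      refine Finset.sum_congr rfl fun j _ => Finset.sum_congr rfl fun k hk => ?_
      rw [if_neg (Finset.mem_Ioi.1 hk).ne]
      ring
    rw [h4, h1, h2, h3]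
    ring
  have hcross : (∑ j, ∫ y in Ω, logLong ‖X j - y‖) / 2 - N * K / 2 - c * N * N / 2
      ≤ ∑ j, ∫ y in Ω, Real.log ‖X j - y‖ := by
    have h : ∀ j, (∫ y in Ω, logLong ‖X j - y‖) / 2 - (K / 2 + c * N / 2)
        ≤ ∫ y in Ω, Real.log ‖X j - y‖ := fun j => by
      rw [setIntegral_log_norm_sub hb hm, hvol']
      linarith [setIntegral_logShort_le (Ω := Ω) (X j)]
    have h' := Finset.sum_le_sum fun j (_ : j ∈ Finset.univ) => h j
    rw [Finset.sum_sub_distrib, ← Finset.sum_div] at h'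
    simp only [Finset.sum_const, Finset.card_univ, Fintype.card_fin, nsmul_eq_mul] at h'
    linarith
  have hself : ∫ x in Ω, ∫ y in Ω, Real.log ‖x - y‖
      ≤ (∫ x in Ω, ∫ y in Ω, logLong ‖x - y‖) / 2 - c * N * N / 2 := by
    have : IsFiniteMeasure (volume.restrict Ω) := ⟨by simpa using hb.measure_lt_top⟩
    obtain ⟨R, hR⟩ := hb.exists_norm_le
    have hRν : ∀ᵐ x ∂(volume.restrict Ω), ‖x‖ ≤ R := by
      filter_upwards [ae_restrict_mem hm] with x hx using hR x hx
    have h1 : IntegrableOn (fun x => ∫ y in Ω, logLong ‖x - y‖) Ω :=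
      (integrable_logLong (integrable_norm_sub_sq hRν hRν)).integral_prod_left
    have h2 := integrableOn_setIntegral_logShort hb
    simp only [setIntegral_log_norm_sub hb hm, hvol']
    have h12 : IntegrableOn (fun x => (∫ y in Ω, logLong ‖x - y‖)
      - ∫ y in Ω, logShort ‖x - y‖) Ω := h1.sub h2
    rw [integral_div, integral_sub h12 (integrable_const _), integral_sub h1 h2]
    have h3 : 0 ≤ ∫ x in Ω, ∫ y in Ω, logShort ‖x - y‖ :=
      integral_nonneg fun x => setIntegral_logShort_nonneg x
    have h4 : ∫ _ in Ω, (logLong 1 - logShort 1) * (N : ℝ) = c * N * N := by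
      simp [hvol', ← hc]
      ring
    rw [h4]
    linarith
  have hneg := sum_logLong_add_le X hb hm hvol'
  have hcN : c * N ≤ |c| * N := by gcongr; exact le_abs_self c
  have hN0 : (0 : ℝ) ≤ N := N.cast_nonneg
  rw [hpairs]
  nlinarith

end
end

section
/- Let d ≥ 1 and 0 < α ≤ 2. Let N be a positive integer, Ω ⊂ ℝ^d a bounded measurable set with |Ω| = N, and x_1,…,x_N ∈ ℝ^d. Then −Σ_{1≤j<k≤N} |x_j−x_k|^α + Σ_{j=1}^N ∫_Ω |x_j−y|^α dy − (1/2) ∫_Ω∫_Ω |x−y|^α dx dy ≥ 0. -/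
open MeasureTheory Real Set
open scoped ENNReal BigOperators

noncomputable section

lemma one_sub_exp_mul_rpow_nonneg {u t : ℝ} (hu : 0 ≤ u) (ht : 0 ≤ t) (q : ℝ) :
    0 ≤ (1 - exp (-u)) * t ^ q :=
  mul_nonneg (sub_nonneg.2 (exp_le_one_iff.2 (neg_nonpos.2 hu))) (rpow_nonneg ht _)

lemma integrableOn_one_sub_exp_mul_rpow {p : ℝ} (hp0 : 0 < p) (hp1 : p < 1) :
    IntegrableOn (fun t : ℝ => (1 - exp (-t)) * t ^ (-1 - p)) (Ioi 0) := by
  have hm : Measurable (fun t : ℝ => (1 - exp (-t)) * t ^ (-1 - p)) := by fun_prop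
  rw [← Ioc_union_Ioi_eq_Ioi zero_le_one]
  refine IntegrableOn.union ?_ ?_
  · have h : IntegrableOn (fun t : ℝ => t ^ (-p)) (Ioc 0 1) :=
      (intervalIntegral.intervalIntegrable_rpow' (by linarith)).1
    refine Integrable.mono' h hm.aestronglyMeasurable
      (ae_restrict_of_forall_mem measurableSet_Ioc fun t ht => ?_)
    rw [norm_of_nonneg (one_sub_exp_mul_rpow_nonneg ht.1.le ht.1.le _)]
    calc (1 - exp (-t)) * t ^ (-1 - p) ≤ t * t ^ (-1 - p) :=
          mul_le_mul_of_nonneg_right (by linarith [add_one_le_exp (-t)]) (rpow_nonneg ht.1.le _)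
      _ = t ^ (-p) := by
          rw [mul_comm, ← rpow_add_one ht.1.ne']
          congr 1
          ring
  · refine Integrable.mono' (integrableOn_Ioi_rpow_of_lt (a := -1 - p) (by linarith) zero_lt_one)
      hm.aestronglyMeasurable (ae_restrict_of_forall_mem measurableSet_Ioi fun t ht => ?_)
    have ht0 : 0 ≤ t := zero_le_one.trans (le_of_lt ht)
    rw [norm_of_nonneg (one_sub_exp_mul_rpow_nonneg ht0 ht0 _)]
    exact mul_le_of_le_one_left (rpow_nonneg ht0 _) (by linarith [exp_pos (-t)])

lemma integral_one_sub_exp_mul_rpow_pos {p : ℝ} (hp0 : 0 < p) (hp1 : p < 1) :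
    0 < ∫ t in Ioi (0 : ℝ), (1 - exp (-t)) * t ^ (-1 - p) := by
  rw [setIntegral_pos_iff_support_of_nonneg_ae
    (ae_restrict_of_forall_mem measurableSet_Ioi fun t ht =>
      one_sub_exp_mul_rpow_nonneg (le_of_lt ht) (le_of_lt ht) _)
    (integrableOn_one_sub_exp_mul_rpow hp0 hp1)]
  refine lt_of_lt_of_le (by simp : 0 < volume (Ioi (0 : ℝ))) (measure_mono fun t ht => ⟨?_, ht⟩)
  have ht : 0 < t := ht
  exact (mul_pos (sub_pos.2 (exp_lt_one_iff.2 (neg_lt_zero.2 ht))) (rpow_pos_of_pos ht _)).ne'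

/-- Scaling turns the subordination integral into the power `r ^ p`. -/
lemma integral_one_sub_exp_scaled {p r : ℝ} (hp0 : 0 < p) (hp1 : p < 1) (hr : 0 ≤ r) :
    IntegrableOn (fun t : ℝ => (1 - exp (-(t * r))) * t ^ (-1 - p)) (Ioi 0) ∧
    ∫ t in Ioi (0 : ℝ), (1 - exp (-(t * r))) * t ^ (-1 - p) =
      (∫ t in Ioi (0 : ℝ), (1 - exp (-t)) * t ^ (-1 - p)) * r ^ p := by
  rcases hr.eq_or_lt with rfl | hr
  · simp [zero_rpow hp0.ne']
  have hcongr : EqOn (fun t : ℝ => (1 - exp (-(t * r))) * t ^ (-1 - p))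
      (fun t => r ^ (1 + p) * ((1 - exp (-(r * t))) * (r * t) ^ (-1 - p))) (Ioi 0) := by
    intro t ht
    have h1 : r ^ (1 + p) * r ^ (-1 - p) = 1 := by
      rw [← rpow_add hr, show 1 + p + (-1 - p) = 0 by ring, rpow_zero]
    simp only [mul_rpow hr.le (le_of_lt ht), mul_comm t r]
    linear_combination (-((1 - exp (-(r * t))) * t ^ (-1 - p))) * h1
  have hi := (integrableOn_Ioi_comp_mul_left_iff
    (fun t : ℝ => (1 - exp (-t)) * t ^ (-1 - p)) 0 hr).2
      (by simpa using integrableOn_one_sub_exp_mul_rpow hp0 hp1)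
  refine ⟨(integrableOn_congr_fun hcongr measurableSet_Ioi).2 (hi.const_mul _), ?_⟩
  rw [setIntegral_congr_fun measurableSet_Ioi hcongr, integral_const_mul,
    integral_comp_mul_left_Ioi (fun t : ℝ => (1 - exp (-t)) * t ^ (-1 - p)) 0 hr, mul_zero,
    smul_eq_mul, rpow_add hr, rpow_one]
  field_simp

/-- The kernel `k (x - y)` satisfies the energy-distance inequality
`∬ k dμdμ + ∬ k dνdν ≤ 2 ∬ k dμdν`. -/
def EnergyIneq {E : Type*} [MeasurableSpace E] [Sub E] (μ ν : Measure E) (k : E → ℝ≥0∞) : Prop :=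
  ∫⁻ p, k (p.1 - p.2) ∂(μ.prod μ) + ∫⁻ p, k (p.1 - p.2) ∂(ν.prod ν) ≤
    2 * ∫⁻ p, k (p.1 - p.2) ∂(μ.prod ν)

namespace EnergyIneq

section General

variable {E : Type*} [MeasurableSpace E] [AddGroup E] [MeasurableSub₂ E]
  {μ ν : Measure E} [SFinite μ] [SFinite ν]

/-- The inequality is preserved under mixtures of kernels. -/
lemma lintegral {S : Type*} [MeasurableSpace S] {ρ : Measure S} [SFinite ρ] {f : S → E → ℝ≥0∞}
    (hf : Measurable (Function.uncurry f)) (h : ∀ᵐ s ∂ρ, EnergyIneq μ ν (f s)) :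
    EnergyIneq μ ν (fun z => ∫⁻ s, f s z ∂ρ) := by
  have hm : Measurable (fun q : (E × E) × S => f q.2 (q.1.1 - q.1.2)) :=
    hf.comp (measurable_snd.prodMk (by fun_prop))
  have hm' : Measurable (fun q : S × (E × E) => f q.1 (q.2.1 - q.2.2)) :=
    hf.comp (measurable_fst.prodMk (by fun_prop))
  have hswap (κ : Measure (E × E)) [SFinite κ] :
      ∫⁻ p, ∫⁻ s, f s (p.1 - p.2) ∂ρ ∂κ = ∫⁻ s, ∫⁻ p, f s (p.1 - p.2) ∂κ ∂ρ :=
    lintegral_lintegral_swap hm.aemeasurable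
  unfold EnergyIneq
  rw [hswap, hswap, hswap, ← lintegral_add_left hm'.lintegral_prod_right',
    ← lintegral_const_mul _ hm'.lintegral_prod_right']
  exact lintegral_mono_ae h

end General

section Scaling

variable {E : Type*} [MeasurableSpace E] [AddGroup E] [MeasurableSub₂ E] {μ ν : Measure E}

lemma of_const_mul {c : ℝ≥0∞} (hc : c ≠ 0) (hc' : c ≠ ∞) {k : E → ℝ≥0∞} (hk : Measurable k)
    (h : EnergyIneq μ ν (fun z => c * k z)) : EnergyIneq μ ν k := by
  have hm : Measurable (fun p : E × E => k (p.1 - p.2)) := hk.comp (by fun_prop)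
  unfold EnergyIneq at h ⊢
  rw [lintegral_const_mul _ hm, lintegral_const_mul _ hm, lintegral_const_mul _ hm, ← mul_add,
    mul_left_comm] at h
  exact (ENNReal.mul_le_mul_iff_right hc hc').1 h

/-- The inequality passes to limits of kernels dominated by the limit. -/
lemma of_tendsto {f : ℕ → E → ℝ≥0∞} {k : E → ℝ≥0∞} (hf : ∀ n, Measurable (f n))
    (hle : ∀ n z, f n z ≤ k z)
    (hlim : ∀ z, Filter.Tendsto (fun n => f n z) Filter.atTop (nhds (k z)))
    (h : ∀ n, EnergyIneq μ ν (f n)) : EnergyIneq μ ν k := by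
  have hm (n : ℕ) : Measurable (fun p : E × E => f n (p.1 - p.2)) := (hf n).comp (by fun_prop)
  have hT (κ : Measure (E × E)) : Filter.Tendsto (fun n => ∫⁻ p, f n (p.1 - p.2) ∂κ) Filter.atTop
      (nhds (∫⁻ p, k (p.1 - p.2) ∂κ)) := by
    refine tendsto_of_le_liminf_of_limsup_le ?_ ?_
    · refine le_trans (lintegral_mono fun p => ?_) (lintegral_liminf_le hm)
      exact (hlim _).liminf_eq.ge
    · refine Filter.limsup_le_of_le (by isBoundedDefault) (.of_forall fun n => ?_)
      exact lintegral_mono fun p => hle n _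
  exact le_of_tendsto_of_tendsto ((hT _).add (hT _))
    (ENNReal.Tendsto.const_mul (hT _) (.inr (by simp))) (.of_forall h)

end Scaling

section Euclidean

variable {E : Type*} [NormedAddCommGroup E] [InnerProductSpace ℝ E] [MeasurableSpace E]
  [BorelSpace E] [SecondCountableTopology E] {μ ν : Measure E} [IsFiniteMeasure μ]
  [IsFiniteMeasure ν]

lemma one_sub_cos_inner (hμν : μ univ = ν univ) (ξ : E) :
    EnergyIneq μ ν (fun z => ENNReal.ofReal (1 - cos (inner ℝ z ξ))) := by
  have key (σ τ : Measure E) [IsFiniteMeasure σ] [IsFiniteMeasure τ] :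
      Integrable (fun p : E × E => 1 - cos (inner ℝ (p.1 - p.2) ξ)) (σ.prod τ) ∧
      ∫ p, (1 - cos (inner ℝ (p.1 - p.2) ξ)) ∂(σ.prod τ) = σ.real univ * τ.real univ
        - ((∫ x, cos (inner ℝ x ξ) ∂σ) * (∫ x, cos (inner ℝ x ξ) ∂τ)
        + (∫ x, sin (inner ℝ x ξ) ∂σ) * (∫ x, sin (inner ℝ x ξ) ∂τ)) := by
    have hc : Integrable (fun p : E × E => cos (inner ℝ p.1 ξ) * cos (inner ℝ p.2 ξ))
        (σ.prod τ) := by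
      refine .of_bound (Continuous.aestronglyMeasurable (by fun_prop)) 1 (.of_forall fun p => ?_)
      rw [norm_mul]
      exact mul_le_one₀ (abs_cos_le_one _) (norm_nonneg _) (abs_cos_le_one _)
    have hs : Integrable (fun p : E × E => sin (inner ℝ p.1 ξ) * sin (inner ℝ p.2 ξ))
        (σ.prod τ) := by
      refine .of_bound (Continuous.aestronglyMeasurable (by fun_prop)) 1 (.of_forall fun p => ?_)
      rw [norm_mul]
      exact mul_le_one₀ (abs_sin_le_one _) (norm_nonneg _) (abs_sin_le_one _)
    simp_rw [inner_sub_left, cos_sub]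
    refine ⟨(integrable_const _).sub (hc.add hs), ?_⟩
    rw [integral_sub (integrable_const _) (by exact hc.add hs), integral_add hc hs,
      integral_prod_mul (fun x => cos (inner ℝ x ξ)) (fun x => cos (inner ℝ x ξ)),
      integral_prod_mul (fun x => sin (inner ℝ x ξ)) (fun x => sin (inner ℝ x ξ))]
    simp [measureReal_prod_prod, ← univ_prod_univ]
  have hnn (σ τ : Measure E) :
      0 ≤ᵐ[σ.prod τ] (fun p : E × E => 1 - cos (inner ℝ (p.1 - p.2) ξ)) :=
    .of_forall fun p => sub_nonneg.2 (cos_le_one _)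
  have hmass : μ.real univ = ν.real univ := by simp [measureReal_def, hμν]
  unfold EnergyIneq
  rw [← ofReal_integral_eq_lintegral_ofReal (key μ μ).1 (hnn _ _),
    ← ofReal_integral_eq_lintegral_ofReal (key ν ν).1 (hnn _ _),
    ← ofReal_integral_eq_lintegral_ofReal (key μ ν).1 (hnn _ _),
    ← ENNReal.ofReal_add (integral_nonneg_of_ae (hnn _ _)) (integral_nonneg_of_ae (hnn _ _)),
    show (2 : ℝ≥0∞) = ENNReal.ofReal 2 by simp, ← ENNReal.ofReal_mul zero_le_two]
  refine ENNReal.ofReal_le_ofReal ?_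
  rw [(key μ μ).2, (key ν ν).2, (key μ ν).2, hmass]
  nlinarith [sq_nonneg ((∫ x, cos (inner ℝ x ξ) ∂μ) - ∫ x, cos (inner ℝ x ξ) ∂ν),
    sq_nonneg ((∫ x, sin (inner ℝ x ξ) ∂μ) - ∫ x, sin (inner ℝ x ξ) ∂ν)]

variable [FiniteDimensional ℝ E]

lemma one_sub_exp (hμν : μ univ = ν univ) {t : ℝ} (ht : 0 ≤ t) :
    EnergyIneq μ ν (fun z => ENNReal.ofReal (1 - exp (-(t * ‖z‖ ^ 2)))) := by
  set s : ℝ := √(2 * t)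
  have hs : s ^ 2 = 2 * t := sq_sqrt (by positivity)
  have hcos (z : E) : Integrable (fun ξ : E => cos (inner ℝ z (s • ξ)))
      (ProbabilityTheory.stdGaussian E) :=
    .of_bound (Continuous.aestronglyMeasurable (by fun_prop)) 1
      (.of_forall fun p => abs_cos_le_one _)
  have hg (z : E) : ∫ ξ, cos (inner ℝ z (s • ξ)) ∂ProbabilityTheory.stdGaussian E
      = exp (-(t * ‖z‖ ^ 2)) := by
    have h := congrArg Complex.re (ProbabilityTheory.charFun_stdGaussian (s • z))
    rw [charFun_apply, ← RCLike.re_eq_complex_re, ← integral_re] at h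
    · simp only [RCLike.re_eq_complex_re, Complex.exp_ofReal_mul_I_re] at h
      rw [show (-(‖s • z‖ : ℂ) ^ 2 / 2) = ((-(t * ‖z‖ ^ 2) : ℝ) : ℂ) by
        rw [norm_smul, norm_of_nonneg (sqrt_nonneg _)]
        have : (s : ℂ) ^ 2 = 2 * t := by exact_mod_cast hs
        push_cast
        linear_combination (-(‖z‖ : ℂ) ^ 2 / 2) * this, Complex.exp_ofReal_re] at h
      rw [← h]
      simp_rw [inner_smul_right, real_inner_comm]
    · refine .of_bound (Continuous.aestronglyMeasurable (by fun_prop)) 1 (.of_forall fun p => ?_)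
      rw [Complex.norm_exp_ofReal_mul_I]
  have h := lintegral (ρ := ProbabilityTheory.stdGaussian E)
    (f := fun ξ z => ENNReal.ofReal (1 - cos (inner ℝ z (s • ξ))))
    (by
      unfold Function.uncurry
      exact (Continuous.measurable (by fun_prop)).ennreal_ofReal)
    (.of_forall fun ξ => one_sub_cos_inner hμν (s • ξ))
  convert h using 2 with z
  rw [← ofReal_integral_eq_lintegral_ofReal (by exact (integrable_const _).sub (hcos z))
    (.of_forall fun ξ => sub_nonneg.2 (cos_le_one _)),
    integral_sub (integrable_const _) (hcos z), hg]
  simp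

lemma norm_sq (hμν : μ univ = ν univ) :
    EnergyIneq μ ν (fun z => ENNReal.ofReal (‖z‖ ^ 2)) := by
  let t : ℕ → ℝ := fun n => 1 / ((n : ℝ) + 1)
  have htpos (n : ℕ) : 0 < t n := by positivity
  have htlim : Filter.Tendsto t Filter.atTop (nhdsWithin 0 {0}ᶜ) :=
    tendsto_nhdsWithin_iff.2 ⟨tendsto_one_div_add_atTop_nhds_zero_nat,
      .of_forall fun n => (htpos n).ne'⟩
  refine of_tendsto (f := fun n z => ENNReal.ofReal ((t n)⁻¹ * (1 - exp (-(t n * ‖z‖ ^ 2)))))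
    (fun n => by fun_prop) (fun n z => ENNReal.ofReal_le_ofReal ?_)
    (fun z => ENNReal.tendsto_ofReal ?_) (fun n => ?_)
  · rw [inv_mul_le_iff₀ (htpos n)]
    linarith [add_one_le_exp (-(t n * ‖z‖ ^ 2))]
  · have hd : HasDerivAt (fun u : ℝ => 1 - exp (-(u * ‖z‖ ^ 2))) (‖z‖ ^ 2) 0 := by
      have := ((((hasDerivAt_id (0 : ℝ)).mul_const (‖z‖ ^ 2)).neg).exp).const_sub 1
      simpa using this
    have := (hasDerivAt_iff_tendsto_slope.1 hd).comp htlim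
    refine this.congr fun n => ?_
    simp [slope_def_field, div_eq_inv_mul]
  · refine of_const_mul (c := ENNReal.ofReal (t n)) (by simpa using htpos n) (by simp)
      (by fun_prop) ?_
    simp_rw [← ENNReal.ofReal_mul (htpos n).le, mul_inv_cancel_left₀ (htpos n).ne']
    exact one_sub_exp hμν (htpos n).le

lemma norm_rpow (hμν : μ univ = ν univ) {α : ℝ} (hα0 : 0 < α) (hα2 : α ≤ 2) :
    EnergyIneq μ ν (fun z => ENNReal.ofReal (‖z‖ ^ α)) := by
  rcases hα2.eq_or_lt with rfl | hlt
  · simpa using norm_sq hμν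
  have h := lintegral (μ := μ) (ν := ν) (ρ := volume.restrict (Ioi (0 : ℝ)))
    (f := fun t (z : E) => ENNReal.ofReal ((1 - exp (-(t * ‖z‖ ^ 2))) * t ^ (-1 - α / 2)))
    (by unfold Function.uncurry; fun_prop)
    (ae_restrict_of_forall_mem measurableSet_Ioi fun t ht => by
      have ht : 0 < t := ht
      have hp : 0 < t ^ (-1 - α / 2) := rpow_pos_of_pos ht _
      refine of_const_mul (c := ENNReal.ofReal (t ^ (-1 - α / 2))⁻¹)
        (by simpa using hp) (by simp) (by fun_prop) ?_
      convert one_sub_exp hμν ht.le using 2 with z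
      rw [← ENNReal.ofReal_mul (by positivity)]
      congr 1
      field_simp)
  have hC := integrableOn_one_sub_exp_mul_rpow (p := α / 2) (by linarith) (by linarith)
  refine of_const_mul
    (c := ENNReal.ofReal (∫ t in Ioi (0 : ℝ), (1 - exp (-t)) * t ^ (-1 - α / 2))) ?_ (by simp)
    (by fun_prop) ?_
  · simpa using integral_one_sub_exp_mul_rpow_pos (p := α / 2) (by linarith) (by linarith)
  · convert h using 2 with z
    have hr : ‖z‖ ^ α = (‖z‖ ^ 2) ^ (α / 2) := by
      rw [← rpow_natCast, ← rpow_mul (norm_nonneg _)]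
      congr 1
      push_cast
      ring
    obtain ⟨hi, he⟩ := integral_one_sub_exp_scaled (p := α / 2) (by linarith) (by linarith)
      (sq_nonneg ‖z‖)
    rw [hr, ← ENNReal.ofReal_mul' (by positivity), ← he, ofReal_integral_eq_lintegral_ofReal hi]
    refine ae_restrict_of_forall_mem measurableSet_Ioi fun t ht => ?_
    exact one_sub_exp_mul_rpow_nonneg (mul_nonneg (le_of_lt ht) (sq_nonneg _)) (le_of_lt ht) _

end Euclidean

end EnergyIneq

lemma integrable_norm_sub_rpow {E : Type*} [NormedAddCommGroup E] [MeasurableSpace E]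
    [BorelSpace E] [SecondCountableTopology E] {μ ν : Measure E} [IsFiniteMeasure μ]
    [IsFiniteMeasure ν] {R α : ℝ} (hα : 0 ≤ α) (hμ : ∀ᵐ x ∂μ, ‖x‖ ≤ R) (hν : ∀ᵐ x ∂ν, ‖x‖ ≤ R) :
    Integrable (fun p : E × E => ‖p.1 - p.2‖ ^ α) (μ.prod ν) := by
  refine .of_bound (by fun_prop) ((R + R) ^ α) ?_
  filter_upwards [Measure.quasiMeasurePreserving_fst.ae hμ,
    Measure.quasiMeasurePreserving_snd.ae hν] with p h1 h2
  rw [norm_of_nonneg (by positivity)]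
  exact rpow_le_rpow (norm_nonneg _) ((norm_sub_le _ _).trans (add_le_add h1 h2)) hα

lemma integral_norm_sub_rpow_add_le {E : Type*} [NormedAddCommGroup E] [InnerProductSpace ℝ E]
    [FiniteDimensional ℝ E] [MeasurableSpace E] [BorelSpace E] {μ ν : Measure E}
    [IsFiniteMeasure μ] [IsFiniteMeasure ν] (hμν : μ univ = ν univ) {R α : ℝ} (hα0 : 0 < α)
    (hα2 : α ≤ 2) (hμ : ∀ᵐ x ∂μ, ‖x‖ ≤ R) (hν : ∀ᵐ x ∂ν, ‖x‖ ≤ R) :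
    (∫ x, ∫ y, ‖x - y‖ ^ α ∂μ ∂μ) + (∫ x, ∫ y, ‖x - y‖ ^ α ∂ν ∂ν) ≤
      2 * ∫ x, ∫ y, ‖x - y‖ ^ α ∂ν ∂μ := by
  have h := EnergyIneq.norm_rpow hμν hα0 hα2
  have hnn (κ : Measure (E × E)) : 0 ≤ᵐ[κ] (fun p : E × E => ‖p.1 - p.2‖ ^ α) :=
    .of_forall fun p => by positivity
  have i1 := integrable_norm_sub_rpow hα0.le hμ hμ
  have i2 := integrable_norm_sub_rpow hα0.le hν hν
  have i3 := integrable_norm_sub_rpow hα0.le hμ hν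
  unfold EnergyIneq at h
  rw [← ofReal_integral_eq_lintegral_ofReal i1 (hnn _),
    ← ofReal_integral_eq_lintegral_ofReal i2 (hnn _),
    ← ofReal_integral_eq_lintegral_ofReal i3 (hnn _),
    ← ENNReal.ofReal_add (integral_nonneg_of_ae (hnn _)) (integral_nonneg_of_ae (hnn _)),
    show (2 : ℝ≥0∞) = ENNReal.ofReal 2 by simp, ← ENNReal.ofReal_mul zero_le_two,
    ENNReal.ofReal_le_ofReal_iff
      (mul_nonneg zero_le_two (integral_nonneg_of_ae (hnn _)))] at h
  rwa [integral_prod _ i1, integral_prod _ i2, integral_prod _ i3] at h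

lemma sum_sum_eq_two_mul_sum_Ioi {N : ℕ} {f : Fin N → Fin N → ℝ} (hf : ∀ i j, f i j = f j i)
    (h0 : ∀ i, f i i = 0) : ∑ i, ∑ j, f i j = 2 * ∑ i, ∑ j ∈ Finset.Ioi i, f i j := by
  have h := Finset.sum_sum_Ioi_add_eq_sum_sum_off_diag f
  calc ∑ i, ∑ j, f i j = ∑ i, ∑ j ∈ {i}ᶜ, f j i := by
        refine Finset.sum_congr rfl fun i _ => ?_
        rw [← Finset.sum_add_sum_compl {i}, Finset.sum_singleton, h0, zero_add]
        exact Finset.sum_congr rfl fun j _ => hf i j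
    _ = 2 * ∑ i, ∑ j ∈ Finset.Ioi i, f i j := by
        simp_rw [← h, Finset.mul_sum, two_mul]
        exact Finset.sum_congr rfl fun i _ => Finset.sum_congr rfl fun j _ => by rw [hf j i]

/-- nonnegativity of the Riesz Jellium energy for `-2 ≤ s < 0`
under neutrality. For `d ≥ 1`, `0 < α ≤ 2`, `|Ω| = N` and any points `x₁,…,x_N`,
`-Σ_{j<k} |x_j-x_k|^α + Σ_j ∫_Ω |x_j-y|^α dy - ½ ∬_Ω |x-y|^α dx dy ≥ 0`. -/
theorem statement10 (d : ℕ) (hd : 1 ≤ d) (α : ℝ) (hα0 : 0 < α) (hα2 : α ≤ 2)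
    (N : ℕ) (hN : 0 < N) (Ω : Set (Eu d)) (hΩmeas : MeasurableSet Ω)
    (hΩbdd : Bornology.IsBounded Ω) (hΩvol : volume Ω = N)
    (X : Fin N → Eu d) :
    0 ≤ -(∑ j : Fin N, ∑ k ∈ Finset.Ioi j, ‖X j - X k‖ ^ α)
          + (∑ j, ∫ y in Ω, ‖X j - y‖ ^ α)
          - (1 / 2) * ∫ x in Ω, ∫ y in Ω, ‖x - y‖ ^ α := by
  have hΩfin : IsFiniteMeasure (volume.restrict Ω) := ⟨by simp [hΩvol]⟩
  obtain ⟨R, hR⟩ := hΩbdd.exists_norm_le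
  let μ : Measure (Eu d) := ∑ j, Measure.dirac (X j)
  let M : ℝ := max R (∑ j, ‖X j‖)
  have hμ : ∀ᵐ x ∂μ, ‖x‖ ≤ M := by
    rw [ae_iff, Measure.finsetSum_apply, Finset.sum_eq_zero_iff]
    intro j _
    rw [← ae_iff, ae_dirac_iff (measurableSet_le measurable_norm measurable_const)]
    exact le_max_of_le_right
      (Finset.single_le_sum (f := fun j => ‖X j‖) (fun _ _ => norm_nonneg _) (Finset.mem_univ j))
  have hν : ∀ᵐ x ∂(volume.restrict Ω), ‖x‖ ≤ M :=
    ae_restrict_of_forall_mem hΩmeas fun x hx => le_max_of_le_left (hR x hx)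
  have h := integral_norm_sub_rpow_add_le (μ := μ) (ν := volume.restrict Ω)
    (by simp [μ, hΩvol]) hα0 hα2 hμ hν
  have hsum (g : Eu d → ℝ) : ∫ x, g x ∂μ = ∑ j, g (X j) := by
    rw [integral_finsetSum_measure fun j _ => integrable_dirac (by simp)]
    simp
  simp_rw [hsum] at h
  rw [sum_sum_eq_two_mul_sum_Ioi (fun i j => by rw [norm_sub_rev])
    (fun i => by simp [zero_rpow hα0.ne'])] at h
  linarith

end
end

section
/- Let d ≥ 1, let N be a positive integer, let Ω ⊂ ℝ^d be a bounded measurable set with |Ω| = N, and let x_1,…,x_N ∈ ℝ^d. Then −Σ_{1≤j<k≤N} |x_j−x_k|² + Σ_{j=1}^N ∫_Ω |x_j−y|² dy − (1/2) ∫_Ω∫_Ω |x−y|² dx dy = |P|², where P = Σ_{j=1}^N x_j − ∫_Ω y dy is the dipole moment of the configuration. -/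
open MeasureTheory Real Set
open scoped ENNReal BigOperators

noncomputable section

/-- Lagrange's identity: the sum of the squared pairwise distances of `n` vectors. -/
theorem sum_Ioi_norm_sub_sq {E : Type*} [NormedAddCommGroup E] [InnerProductSpace ℝ E]
    {n : ℕ} (X : Fin n → E) :
    ∑ j, ∑ k ∈ Finset.Ioi j, ‖X j - X k‖ ^ 2 = n * ∑ j, ‖X j‖ ^ 2 - ‖∑ j, X j‖ ^ 2 := by
  have h1 := Finset.sum_sum_Ioi_add_eq_sum_sum_off_diag fun j k => ‖X j - X k‖ ^ 2
  have h2 : ∀ i, ∑ j ∈ {i}ᶜ, ‖X j - X i‖ ^ 2 = ∑ j, ‖X j - X i‖ ^ 2 := fun i =>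
    Finset.sum_subset (Finset.subset_univ _) fun j _ hj => by
      have : j = i := by simpa using hj
      simp [this]
  have h3 : ∑ i, ∑ j, ‖X j - X i‖ ^ 2 = 2 * (n * ∑ j, ‖X j‖ ^ 2 - ‖∑ j, X j‖ ^ 2) := by
    simp only [norm_sub_sq_real, Finset.sum_add_distrib, Finset.sum_sub_distrib,
      ← Finset.mul_sum, ← sum_inner, ← inner_sum, real_inner_self_eq_norm_sq,
      Finset.sum_const, Finset.card_univ, Fintype.card_fin, nsmul_eq_mul]
    ring
  simp only [h2, h3, Finset.sum_add_distrib] at h1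
  simp only [fun j k => norm_sub_rev (X k) (X j)] at h1
  linarith

/-- The second moment of a measure about a point `a`. -/
theorem integral_norm_sub_sq {E : Type*} [NormedAddCommGroup E] [InnerProductSpace ℝ E]
    [CompleteSpace E] [MeasurableSpace E] {μ : Measure E} [IsFiniteMeasure μ]
    (h1 : Integrable (fun y => y) μ) (h2 : Integrable (fun y => ‖y‖ ^ 2) μ) (a : E) :
    ∫ y, ‖a - y‖ ^ 2 ∂μ
      = μ.real univ * ‖a‖ ^ 2 - 2 * inner ℝ a (∫ y, y ∂μ) + ∫ y, ‖y‖ ^ 2 ∂μ := by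
  have hi : Integrable (fun y => 2 * inner ℝ a y) μ := (h1.const_inner a).const_mul 2
  simp only [norm_sub_sq_real]
  have hs : Integrable (fun y => ‖a‖ ^ 2 - 2 * inner ℝ a y) μ := (integrable_const _).sub hi
  rw [integral_add hs h2, integral_sub (integrable_const _) hi,
    integral_const, integral_const_mul, integral_inner h1 a, smul_eq_mul]

/-- The mutual second moment of a measure with itself. -/
theorem integral_integral_norm_sub_sq {E : Type*} [NormedAddCommGroup E]
    [InnerProductSpace ℝ E] [CompleteSpace E] [MeasurableSpace E] {μ : Measure E}
    [IsFiniteMeasure μ] (h1 : Integrable (fun y => y) μ)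
    (h2 : Integrable (fun y => ‖y‖ ^ 2) μ) :
    ∫ x, ∫ y, ‖x - y‖ ^ 2 ∂μ ∂μ
      = 2 * (μ.real univ * ∫ y, ‖y‖ ^ 2 ∂μ - ‖∫ y, y ∂μ‖ ^ 2) := by
  have hi : Integrable (fun x => 2 * inner ℝ x (∫ y, y ∂μ)) μ :=
    (h1.inner_const _).const_mul 2
  have hn : Integrable (fun x => μ.real univ * ‖x‖ ^ 2) μ := h2.const_mul _
  simp only [integral_norm_sub_sq h1 h2]
  have hs : Integrable (fun x => μ.real univ * ‖x‖ ^ 2 - 2 * inner ℝ x (∫ y, y ∂μ)) μ :=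
    hn.sub hi
  rw [integral_add hs (integrable_const _), integral_sub hn hi, integral_const,
    integral_const_mul, integral_const_mul]
  simp only [fun x => real_inner_comm (∫ y, y ∂μ) x]
  rw [integral_inner h1, real_inner_self_eq_norm_sq, smul_eq_mul]
  ring

/-- exact evaluation of the Riesz Jellium energy at `s = -2`.
Under neutrality `|Ω| = N`,
`-Σ_{j<k} |x_j-x_k|² + Σ_j ∫_Ω |x_j-y|² dy - ½ ∬_Ω |x-y|² dx dy = |P|²` where
`P = Σ_j x_j - ∫_Ω y dy` is the dipole moment. -/
theorem statement11 (d : ℕ) (hd : 1 ≤ d)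
    (N : ℕ) (hN : 0 < N) (Ω : Set (Eu d)) (hΩmeas : MeasurableSet Ω)
    (hΩbdd : Bornology.IsBounded Ω) (hΩvol : volume Ω = N)
    (X : Fin N → Eu d) :
    -(∑ j : Fin N, ∑ k ∈ Finset.Ioi j, ‖X j - X k‖ ^ 2)
        + (∑ j, ∫ y in Ω, ‖X j - y‖ ^ 2)
        - (1 / 2) * ∫ x in Ω, ∫ y in Ω, ‖x - y‖ ^ 2
      = ‖(∑ j, X j) - ∫ y in Ω, y‖ ^ 2 := by
  have hfin : volume Ω ≠ ∞ := by simp [hΩvol]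
  have : IsFiniteMeasure (volume.restrict Ω) := isFiniteMeasure_restrict.2 hfin
  obtain ⟨C, hC⟩ := hΩbdd.exists_norm_le
  have h1 : Integrable (fun y : Eu d => y) (volume.restrict Ω) :=
    Integrable.of_bound (by fun_prop) C (ae_restrict_of_forall_mem hΩmeas hC)
  have h2 : Integrable (fun y : Eu d => ‖y‖ ^ 2) (volume.restrict Ω) :=
    Integrable.of_bound (by fun_prop) (C ^ 2) (ae_restrict_of_forall_mem hΩmeas fun y hy => by
      simpa using pow_le_pow_left₀ (norm_nonneg y) (hC y hy) 2)
  have hm : (volume.restrict Ω).real univ = N := by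
    simp [Measure.real, hΩvol]
  rw [sum_Ioi_norm_sub_sq, integral_integral_norm_sub_sq h1 h2, norm_sub_sq_real]
  simp only [integral_norm_sub_sq h1 h2, hm, Finset.sum_add_distrib, Finset.sum_sub_distrib,
    ← Finset.mul_sum, ← sum_inner, Finset.sum_const, Finset.card_univ, Fintype.card_fin,
    nsmul_eq_mul]
  ring

end
end

section
/- Let d ≥ 1 and 0 < s < d. Let χ : ℝ^d → [0,∞) be a radial function in L¹(ℝ^d) with ∫_{ℝ^d} χ = 1, and suppose I := ∫_{ℝ^d}∫_{ℝ^d} χ(x) χ(y) |x−y|^{s−d} dx dy is finite and positive. Set c = |S^{d−1}| / I, where |S^{d−1}| = 2π^{d/2}/Γ(d/2). Then for every x ∈ ℝ^d with x ≠ 0, |x|^{−s} = c ∫_0^∞ (χ∗χ)(t x) t^{s−1} dt, where (χ∗χ)(z) = ∫_{ℝ^d} χ(y) χ(z−y) dy. -/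
open MeasureTheory Real Set
open scoped ENNReal BigOperators

noncomputable section

/-- The convolution square of a radial function on Euclidean space is radial. -/
theorem integral_mul_sub_eq_of_norm_eq {d : ℕ} {χ : Eu d → ℝ}
    (hχ : ∀ x y : Eu d, ‖x‖ = ‖y‖ → χ x = χ y) {z w : Eu d} (h : ‖z‖ = ‖w‖) :
    ∫ y, χ y * χ (z - y) = ∫ y, χ y * χ (w - y) := by
  let R : Eu d ≃ₗᵢ[ℝ] Eu d := (ℝ ∙ (z - w))ᗮ.reflection
  have hR : R z = w := Submodule.reflection_sub h
  rw [← R.measurePreserving.integral_comp R.toHomeomorph.measurableEmbedding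
    (fun y => χ y * χ (w - y))]
  refine integral_congr_ae (.of_forall fun y => ?_)
  dsimp only
  rw [hχ (R y) y (R.norm_map y), ← hR, ← map_sub, hχ (R (z - y)) (z - y) (R.norm_map _)]

/-- The change of variables `z = y - x` in a double integral against a kernel depending
only on the norm of the difference. -/
theorem integral_integral_mul_norm_sub {d : ℕ} {χ : Eu d → ℝ}
    (hχ : ∀ x y : Eu d, ‖x‖ = ‖y‖ → χ x = χ y) (k : ℝ → ℝ)
    (hI : Integrable (fun p : Eu d × Eu d => χ p.1 * χ p.2 * k ‖p.1 - p.2‖)) :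
    ∫ x, ∫ y, χ x * χ y * k ‖x - y‖ = ∫ z, (∫ y, χ y * χ (z - y)) * k ‖z‖ := by
  have hshift : Integrable (fun p : Eu d × Eu d => χ p.1 * χ (p.1 + p.2) * k ‖p.2‖)
      (volume.prod volume) := by
    have := (measurePreserving_prod_add (volume : Measure (Eu d))
      (volume : Measure (Eu d))).integrable_comp_of_integrable hI
    simpa [Function.comp_def] using this
  calc
    _ = ∫ x, ∫ z, χ x * χ (x + z) * k ‖z‖ := by
      refine integral_congr_ae (.of_forall fun x => ?_)
      dsimp only
      rw [← integral_add_left_eq_self (fun y => χ x * χ y * k ‖x - y‖) x]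
      simp
    _ = ∫ z, ∫ x, χ x * χ (x + z) * k ‖z‖ := integral_integral_swap hshift
    _ = _ := by
      refine integral_congr_ae (.of_forall fun z => ?_)
      dsimp only
      rw [integral_mul_const,
        ← integral_neg_eq_self (fun x => χ x * χ (x + z))]
      congr 2 with y
      rw [hχ (-y) y (norm_neg y), neg_add_eq_sub]

/-- The surface area of the unit sphere is the dimension times the volume of the unit ball. -/
theorem natCast_mul_volume_real_ball {d : ℕ} (hd : 1 ≤ d) :
    (d : ℝ) * volume.real (Metric.ball (0 : Eu d) 1)
      = 2 * π ^ ((d : ℝ) / 2) / Real.Gamma ((d : ℝ) / 2) := by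
  have : Nonempty (Fin d) := ⟨⟨0, hd⟩⟩
  have hd0 : (0 : ℝ) < d := by exact_mod_cast hd
  have hΓ : 0 < Real.Gamma ((d : ℝ) / 2) := Real.Gamma_pos_of_pos (by positivity)
  have hpow : √π ^ d = π ^ ((d : ℝ) / 2) := by
    rw [Real.sqrt_eq_rpow, ← Real.rpow_natCast, ← Real.rpow_mul pi_pos.le]
    congr 1
    ring
  rw [measureReal_def, EuclideanSpace.volume_ball, Fintype.card_fin, hpow,
    Real.Gamma_add_one (by positivity), ENNReal.ofReal_one, one_pow, one_mul,
    ENNReal.toReal_ofReal (by positivity)]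
  field_simp

/-- scaling representation of the Riesz potential. For
`0 < s < d`, a radial nonnegative `χ ∈ L¹` with `∫ χ = 1` and
`I = ∬ χ(x) χ(y) |x-y|^{s-d} dx dy` finite and positive, setting
`c = |S^{d-1}| / I` one has, for every `x ≠ 0`,
`|x|^{-s} = c ∫₀^∞ (χ∗χ)(t x) t^{s-1} dt`. -/
theorem statement12 (d : ℕ) (hd : 1 ≤ d) (s : ℝ) (hs : 0 < s) (hsd : s < d)
    (χ : Eu d → ℝ) (hχpos : ∀ x, 0 ≤ χ x)
    (hχrad : ∀ x y : Eu d, ‖x‖ = ‖y‖ → χ x = χ y)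
    (hχ1 : Integrable χ) (hχint : ∫ x, χ x = 1)
    (hI : Integrable (fun p : Eu d × Eu d =>
      χ p.1 * χ p.2 * ‖p.1 - p.2‖ ^ (s - (d : ℝ))))
    (hIpos : 0 < ∫ x, ∫ y, χ x * χ y * ‖x - y‖ ^ (s - (d : ℝ)))
    (x : Eu d) (hx : x ≠ 0) :
    ‖x‖ ^ (-s)
      = (2 * π ^ ((d : ℝ) / 2) / Real.Gamma ((d : ℝ) / 2))
          / (∫ x, ∫ y, χ x * χ y * ‖x - y‖ ^ (s - (d : ℝ)))
          * ∫ t in Ioi (0 : ℝ), (∫ y, χ y * χ (t • x - y)) * t ^ (s - 1) := by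
  have : Nontrivial (Eu d) := ⟨⟨x, 0, hx⟩⟩
  have hxn : 0 < ‖x‖ := norm_pos_iff.2 hx
  set I := ∫ x, ∫ y, χ x * χ y * ‖x - y‖ ^ (s - (d : ℝ)) with hIdef
  set e : Eu d := ‖x‖⁻¹ • x with he
  have hen : ‖e‖ = 1 := by rw [he, norm_smul, norm_inv, norm_norm, inv_mul_cancel₀ hxn.ne']
  have hxe : x = ‖x‖ • e := by rw [he, smul_smul, mul_inv_cancel₀ hxn.ne', one_smul]
  set J := ∫ t in Ioi (0 : ℝ), (∫ y, χ y * χ (t • e - y)) * t ^ (s - 1) with hJ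
  have hIJ : I = (2 * π ^ ((d : ℝ) / 2) / Real.Gamma ((d : ℝ) / 2)) * J := by
    have hrad : ∀ z : Eu d, ∫ y, χ y * χ (z - y) = ∫ y, χ y * χ (‖z‖ • e - y) := fun z =>
      integral_mul_sub_eq_of_norm_eq hχrad (by simp [norm_smul, hen])
    rw [hIdef, integral_integral_mul_norm_sub hχrad (fun r => r ^ (s - (d : ℝ))) hI]
    rw [integral_congr_ae (.of_forall fun z => congrArg (· * ‖z‖ ^ (s - (d : ℝ))) (hrad z)),
      integral_fun_norm_addHaar volume
      (fun r => (∫ y, χ y * χ (r • e - y)) * r ^ (s - (d : ℝ))), finrank_euclideanSpace_fin,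
      nsmul_eq_mul, smul_eq_mul, ← mul_assoc, natCast_mul_volume_real_ball hd, hJ]
    congr 1
    refine setIntegral_congr_fun measurableSet_Ioi fun t ht => ?_
    have ht : 0 < t := ht
    rw [smul_eq_mul, mul_left_comm, ← Real.rpow_natCast, ← Real.rpow_add ht,
      Nat.cast_sub hd, Nat.cast_one]
    congr 2
    ring
  have hscale : ∫ t in Ioi (0 : ℝ), (∫ y, χ y * χ (t • x - y)) * t ^ (s - 1)
      = ‖x‖ ^ (-s) * J := by
    have hcomp := integral_comp_mul_left_Ioi
      (fun t => (∫ y, χ y * χ (t • e - y)) * t ^ (s - 1)) 0 hxn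
    rw [mul_zero, smul_eq_mul, ← hJ] at hcomp
    have hfactor : ‖x‖ ^ (-s) = ‖x‖ ^ (1 - s) * ‖x‖⁻¹ := by
      rw [← Real.rpow_neg_one ‖x‖, ← Real.rpow_add hxn]
      congr 1
      ring
    rw [hfactor, mul_assoc, ← hcomp, ← integral_const_mul]
    refine setIntegral_congr_fun measurableSet_Ioi fun t ht => ?_
    have ht : 0 < t := ht
    have hcancel : ‖x‖ ^ (1 - s) * ‖x‖ ^ (s - 1) = 1 := by
      rw [← Real.rpow_add hxn]
      simp
    rw [Real.mul_rpow hxn.le ht.le, mul_comm ‖x‖ t, ← smul_smul, ← hxe, mul_left_comm,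
      ← mul_assoc (‖x‖ ^ (1 - s)), hcancel, one_mul]
  rw [hscale, div_mul_eq_mul_div, mul_left_comm, ← hIJ, mul_div_assoc, div_self hIpos.ne', mul_one]

end
end

section
/- Let d ≥ 1 and −2 ≤ s < d. Let v_1,…,v_N ∈ ℝ^d be such that the translated unit cubes C_1+v_1,…,C_1+v_N are pairwise disjoint, where C_1 = (−1/2,1/2)^d, and set Ω = ⋃_{j=1}^N (C_1+v_j). Then inf_{x_1,…,x_N ∈ ℝ^d} E^{d,s}_Jel(Ω; x_1,…,x_N) ≤ −(N/2) ∫_{C_1}∫_{C_1} V_s(|x−y|) dx dy. -/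
open MeasureTheory Real Set Classical
open scoped ENNReal BigOperators

noncomputable section

/-- The open unit cube `C₁ = (-1/2, 1/2)^d`. -/
def unitCube (d : ℕ) : Set (Eu d) := {y | ∀ i, y i ∈ Ioo (-(1 / 2) : ℝ) (1 / 2)}

/-- Push-forward of a product measure under a pair of distinct coordinates. -/
lemma measurePreserving_eval_pair {ι E : Type*} [Fintype ι] [MeasurableSpace E]
    (μ : ι → Measure E) [∀ i, IsProbabilityMeasure (μ i)] {j k : ι} (h : j ≠ k) :
    MeasurePreserving (fun X : ι → E => (X j, X k)) (Measure.pi μ) ((μ j).prod (μ k)) := by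
  refine ⟨by fun_prop, ?_⟩
  have hind := (ProbabilityTheory.iIndepFun_pi (μ := μ) (X := fun _ x => x)
    (fun _ => aemeasurable_id)).indepFun h
  rw [hind.map_prod_eq_prod_map_map (measurable_pi_apply j).aemeasurable
    (measurable_pi_apply k).aemeasurable]
  exact congrArg₂ _ (measurePreserving_eval μ j).map_eq (measurePreserving_eval μ k).map_eq

/-- First moment of a pair interaction minus a mean-field interaction with the marginals, for
independent particles with laws `μ j`. -/
lemma exists_pair_energy_le {E : Type*} [MeasurableSpace E] {N : ℕ}
    (μ : Fin N → Measure E) [∀ i, IsProbabilityMeasure (μ i)] (W : E → E → ℝ)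
    (hW : ∀ j k, Integrable (Function.uncurry W) ((μ j).prod (μ k)))
    (S : Fin N → Set E) (hS : ∀ j, ∀ᵐ x ∂μ j, x ∈ S j) :
    ∃ X : Fin N → E, (∀ j, X j ∈ S j) ∧
      (∑ j, ∑ k ∈ Finset.Ioi j, W (X j) (X k)) - ∑ j, ∑ k, ∫ y, W (X j) y ∂μ k
        ≤ (∑ j, ∑ k ∈ Finset.Ioi j, ∫ x, ∫ y, W x y ∂μ k ∂μ j)
          - ∑ j, ∑ k, ∫ x, ∫ y, W x y ∂μ k ∂μ j := by
  have h1 (j k : Fin N) (hk : k ∈ Finset.Ioi j) :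
      Integrable (fun X : Fin N → E => W (X j) (X k)) (Measure.pi μ) :=
    (measurePreserving_eval_pair μ (Finset.mem_Ioi.1 hk).ne).integrable_comp_of_integrable (hW j k)
  have h2 (j k : Fin N) :
      Integrable (fun X : Fin N → E => ∫ y, W (X j) y ∂μ k) (Measure.pi μ) :=
    (measurePreserving_eval μ j).integrable_comp_of_integrable (hW j k).integral_prod_left
  have e1 (j k : Fin N) (hk : k ∈ Finset.Ioi j) :
      ∫ X : Fin N → E, W (X j) (X k) ∂Measure.pi μ = ∫ x, ∫ y, W x y ∂μ k ∂μ j := by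
    have hp := measurePreserving_eval_pair μ (Finset.mem_Ioi.1 hk).ne
    rw [integral_integral (f := W) (hW j k), ← hp.map_eq,
      integral_map hp.measurable.aemeasurable]
    rw [hp.map_eq]
    exact (hW j k).aestronglyMeasurable
  have e2 (j k : Fin N) :
      ∫ X : Fin N → E, ∫ y, W (X j) y ∂μ k ∂Measure.pi μ = ∫ x, ∫ y, W x y ∂μ k ∂μ j := by
    have hp := measurePreserving_eval μ j
    conv_rhs => rw [← hp.map_eq]
    rw [integral_map hp.measurable.aemeasurable]
    · rw [hp.map_eq]
      exact (hW j k).integral_prod_left.aestronglyMeasurable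
  have hae : ∀ᵐ X ∂Measure.pi μ, ∀ j, X j ∈ S j :=
    ae_all_iff.2 fun j => (Measure.tendsto_eval_ae_ae (μ := μ) (i := j)).eventually (hS j)
  have i1 : Integrable (fun X : Fin N → E => ∑ j, ∑ k ∈ Finset.Ioi j, W (X j) (X k))
      (Measure.pi μ) :=
    integrable_finsetSum _ fun j _ => integrable_finsetSum _ fun k hk => h1 j k hk
  have i2 : Integrable (fun X : Fin N → E => ∑ j, ∑ k, ∫ y, W (X j) y ∂μ k)
      (Measure.pi μ) :=
    integrable_finsetSum _ fun j _ => integrable_finsetSum _ fun k _ => h2 j k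
  obtain ⟨X, hX, hle⟩ := exists_notMem_null_le_integral (i1.sub i2) (ae_iff.1 hae)
  refine ⟨X, by simpa using hX, hle.trans_eq ?_⟩
  simp only [Pi.sub_apply]
  rw [integral_sub i1 i2,
    integral_finsetSum _ fun j _ => integrable_finsetSum _ fun k hk => h1 j k hk,
    integral_finsetSum _ fun j _ => integrable_finsetSum _ fun k _ => h2 j k]
  congr 1
  · refine Finset.sum_congr rfl fun j _ => ?_
    rw [integral_finsetSum _ fun k hk => h1 j k hk]
    exact Finset.sum_congr rfl fun k hk => e1 j k hk
  · refine Finset.sum_congr rfl fun j _ => ?_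
    rw [integral_finsetSum _ fun k _ => h2 j k]
    exact Finset.sum_congr rfl fun k _ => e2 j k

/-- A symmetric double sum splits into twice its upper triangle and its diagonal. -/
lemma sum_sum_eq_two_mul_sum_Ioi_add {N : ℕ} (a : Fin N → Fin N → ℝ)
    (ha : ∀ j k, a j k = a k j) :
    ∑ j, ∑ k, a j k = 2 * (∑ j, ∑ k ∈ Finset.Ioi j, a j k) + ∑ j, a j j := by
  have hrow (j : Fin N) :
      ∑ k, a j k = ∑ k ∈ Finset.Ioi j, a j k + ∑ k ∈ Finset.Iio j, a j k + a j j := by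
    have hu : (Finset.univ : Finset (Fin N)) = insert j (Finset.Ioi j ∪ Finset.Iio j) := by
      ext k
      simp only [Finset.mem_univ, Finset.mem_insert, Finset.mem_union, Finset.mem_Ioi,
        Finset.mem_Iio, true_iff]
      exact (lt_trichotomy j k).elim (by tauto) (by rintro (h | h) <;> simp [h])
    rw [hu, Finset.sum_insert (by simp), Finset.sum_union, add_comm]
    exact Finset.disjoint_left.2 fun k hk hk' =>
      lt_asymm (Finset.mem_Ioi.1 hk) (Finset.mem_Iio.1 hk')
  have hlow : ∑ j, ∑ k ∈ Finset.Iio j, a j k = ∑ j, ∑ k ∈ Finset.Ioi j, a j k := by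
    rw [Finset.sum_comm' (t' := Finset.univ) (s' := fun k => Finset.Ioi k) (by simp)]
    exact Finset.sum_congr rfl fun j _ => Finset.sum_congr rfl fun k _ => ha k j
  simp only [hrow, Finset.sum_add_distrib, hlow]
  ring

lemma coe_ereal_finsetSum {ι : Type*} (t : Finset ι) (f : ι → ℝ) :
    ((∑ i ∈ t, f i : ℝ) : EReal) = ∑ i ∈ t, (f i : EReal) :=
  map_sum (⟨⟨fun x : ℝ => (x : EReal), EReal.coe_zero⟩, EReal.coe_add⟩ : ℝ →+ EReal) f t

lemma integrableOn_ball_rV_norm {d : ℕ} (hd : 1 ≤ d) {s : ℝ} (hsd : s < d) (R : ℝ) :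
    IntegrableOn (fun z : Eu d => rV s ‖z‖) (Metric.ball 0 R) := by
  rcases le_or_gt R 0 with hR | hR
  · simp [Metric.ball_eq_empty.2 hR]
  have : Nontrivial (Eu d) :=
    Module.nontrivial_of_finrank_pos (R := ℝ) (by rw [finrank_euclideanSpace_fin]; omega)
  rw [integrableOn_fun_norm_addHaar, finrank_euclideanSpace_fin]
  have hpow : IntegrableOn (fun y : ℝ => y ^ (d - 1) • y ^ (-s)) (Ioo 0 R) := by
    have h : IntegrableOn (fun y : ℝ => y ^ ((d : ℝ) - 1 - s)) (Ioo 0 R) :=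
      (intervalIntegral.integrableOn_Ioo_rpow_iff hR).2 (by linarith)
    refine h.congr_fun (fun y hy => ?_) measurableSet_Ioo
    simp only [smul_eq_mul]
    rw [← Real.rpow_natCast, ← Real.rpow_add hy.1, Nat.cast_sub hd]
    simp [sub_eq_add_neg]
  unfold rV
  split_ifs
  · exact hpow
  · have h : IntervalIntegrable (fun y : ℝ => y ^ (d - 1) * -Real.log y) volume 0 R :=
      intervalIntegral.intervalIntegrable_log'.neg.continuousOn_mul (by fun_prop)
    exact ((intervalIntegrable_iff_integrableOn_Ioo_of_le hR.le).1 h)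
  · simpa using hpow.neg

lemma measurable_rV (s : ℝ) : Measurable (rV s) := by
  unfold rV
  split_ifs <;> fun_prop

/-- The Riesz kernel is integrable over products of bounded sets. -/
lemma integrable_rV_norm_sub_prod {d : ℕ} (hd : 1 ≤ d) {s : ℝ} (hsd : s < d) {A B : Set (Eu d)}
    (hA : Bornology.IsBounded A) (hB : Bornology.IsBounded B)
    (hAm : MeasurableSet A) (hBm : MeasurableSet B) :
    Integrable (Function.uncurry fun x y : Eu d => rV s ‖x - y‖)
      ((volume.restrict A).prod (volume.restrict B)) := by
  obtain ⟨R, hR⟩ := (hA.sub hB).subset_ball (0 : Eu d)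
  have hg := (integrable_indicator_iff Metric.isOpen_ball.measurableSet).2
    (integrableOn_ball_rV_norm hd hsd R)
  have hf : Integrable (B.indicator fun _ : Eu d => (1 : ℝ)) :=
    (integrable_indicator_iff hBm).2 (integrableOn_const hB.measure_lt_top.ne)
  have h := hf.convolution_integrand (ContinuousLinearMap.mul ℝ ℝ) hg
  rw [Measure.prod_restrict]
  refine (h.integrableOn (s := A ×ˢ B)).congr_fun (fun p hp => ?_) (hAm.prod hBm)
  have hmem : p.1 - p.2 ∈ Metric.ball (0 : Eu d) R := hR (Set.sub_mem_sub hp.1 hp.2)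
  simp [indicator_of_mem hp.2, indicator_of_mem hmem, Function.uncurry]

lemma integrableOn_rV_norm_sub {d : ℕ} (hd : 1 ≤ d) {s : ℝ} (hsd : s < d) {B : Set (Eu d)}
    (hB : Bornology.IsBounded B) (x : Eu d) :
    IntegrableOn (fun y => rV s ‖x - y‖) B := by
  obtain ⟨R, hR⟩ := hB.subset_ball x
  refine IntegrableOn.mono_set (t := Metric.ball x R) ?_ hR
  have hpre : (fun y : Eu d => x - y) ⁻¹' Metric.ball 0 R = Metric.ball x R := by
    ext y
    simp [dist_eq_norm, norm_sub_rev]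
  rw [← hpre]
  exact ((Measure.measurePreserving_sub_left volume x).integrableOn_comp_preimage
    (MeasurableEquiv.subLeft x).measurableEmbedding).2 (integrableOn_ball_rV_norm hd hsd R)

lemma unitCube_eq_preimage (d : ℕ) :
    unitCube d = WithLp.ofLp ⁻¹' (univ.pi fun _ : Fin d => Ioo (-(1 / 2) : ℝ) (1 / 2)) := by
  ext y
  simp [unitCube]

lemma measurableSet_unitCube (d : ℕ) : MeasurableSet (unitCube d) := by
  rw [unitCube_eq_preimage]
  exact (PiLp.volume_preserving_ofLp (Fin d)).measurable
    (MeasurableSet.univ_pi fun _ => measurableSet_Ioo)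

lemma volume_unitCube (d : ℕ) : volume (unitCube d) = 1 := by
  rw [unitCube_eq_preimage, (PiLp.volume_preserving_ofLp (Fin d)).measure_preimage
    (MeasurableSet.univ_pi fun _ => measurableSet_Ioo).nullMeasurableSet, Real.volume_pi_Ioo]
  norm_num

lemma isBounded_unitCube (d : ℕ) : Bornology.IsBounded (unitCube d) := by
  rw [unitCube_eq_preimage]
  exact (PiLp.antilipschitzWith_ofLp 2 _).isBounded_preimage
    (Bornology.IsBounded.pi fun _ => Metric.isBounded_Ioo _ _)

lemma setIntegral_image_add_right {d : ℕ} (v : Eu d) (A : Set (Eu d)) (f : Eu d → ℝ) :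
    ∫ x in (fun y => y + v) '' A, f x = ∫ x in A, f (x + v) :=
  (measurePreserving_add_right volume v).setIntegral_image_emb
    (MeasurableEquiv.addRight v).measurableEmbedding f A

/-- upper bound by one particle per unit cube. For `-2 ≤ s < d`
and `Ω` a disjoint union of `N` translated unit cubes,
`inf_{x₁,…,x_N} E^{d,s}_Jel(Ω; x₁,…,x_N) ≤ -(N/2) ∬_{C₁×C₁} V_s(|x-y|) dx dy`. -/
theorem statement14 (d : ℕ) (hd : 1 ≤ d) (s : ℝ) (hs : -2 ≤ s) (hsd : s < d)
    (N : ℕ) (v : Fin N → Eu d)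
    (hdisj : ∀ j k : Fin N, j ≠ k →
      Disjoint ((fun y => y + v j) '' unitCube d) ((fun y => y + v k) '' unitCube d))
    (Ω : Set (Eu d)) (hΩ : Ω = ⋃ j, (fun y => y + v j) '' unitCube d) :
    (⨅ X : Fin N → Eu d, rJel d s Ω X)
      ≤ ((-((N : ℝ) / 2 * ∫ x in unitCube d, ∫ y in unitCube d, rV s ‖x - y‖) : ℝ) : EReal) := by
  set Q : Fin N → Set (Eu d) := fun j => (fun y => y + v j) '' unitCube d with hQ
  have hQm (j : Fin N) : MeasurableSet (Q j) :=
    (MeasurableEquiv.addRight (v j)).measurableEmbedding.measurableSet_image.2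
      (measurableSet_unitCube d)
  have hQb (j : Fin N) : Bornology.IsBounded (Q j) := by
    have h := (isBounded_unitCube d).add (Bornology.isBounded_singleton (x := v j))
    rwa [Set.add_singleton] at h
  have hprob (j : Fin N) : IsProbabilityMeasure (volume.restrict (Q j)) := by
    refine ⟨?_⟩
    rw [Measure.restrict_apply_univ, hQ]
    simp [volume_unitCube]
  set W : Eu d → Eu d → ℝ := fun x y => rV s ‖x - y‖ with hWdef
  have hW (j k : Fin N) : Integrable (Function.uncurry W)
      ((volume.restrict (Q j)).prod (volume.restrict (Q k))) :=
    integrable_rV_norm_sub_prod hd hsd (hQb j) (hQb k) (hQm j) (hQm k)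
  set a : Fin N → Fin N → ℝ := fun j k => ∫ x in Q j, ∫ y in Q k, W x y with ha
  have hsymm (j k : Fin N) : a j k = a k j := by
    rw [ha]
    simp only
    rw [integral_integral_swap (hW j k)]
    simp only [hWdef, norm_sub_rev]
  have hdiag (j : Fin N) : a j j = ∫ x in unitCube d, ∫ y in unitCube d, W x y := by
    simp only [ha, hQ, setIntegral_image_add_right, hWdef, add_sub_add_right_eq_sub]
  have hΩx (x : Eu d) : ∫ y in Ω, W x y = ∑ k, ∫ y in Q k, W x y := by
    rw [hΩ]
    exact integral_iUnion_fintype hQm (fun j k h => hdisj j k h)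
      fun k => integrableOn_rV_norm_sub hd hsd (hQb k) x
  have hΩΩ : ∫ x in Ω, ∫ y in Ω, W x y = ∑ j, ∑ k, a j k := by
    have hint (j k : Fin N) : IntegrableOn (fun x => ∫ y in Q k, W x y) (Q j) :=
      (hW j k).integral_prod_left
    simp only [hΩx]
    rw [hΩ, integral_iUnion_fintype hQm (fun j k h => hdisj j k h)
      fun j => integrable_finsetSum _ fun k _ => hint j k]
    exact Finset.sum_congr rfl fun j _ => integral_finsetSum _ fun k _ => hint j k
  obtain ⟨X, hX, hle⟩ := exists_pair_energy_le (fun j => volume.restrict (Q j)) W hW Q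
    fun j => ae_restrict_mem (hQm j)
  have hpair : ∑ j, ∑ k ∈ Finset.Ioi j, rVE s ‖X j - X k‖
      = ((∑ j, ∑ k ∈ Finset.Ioi j, W (X j) (X k) : ℝ) : EReal) := by
    simp only [coe_ereal_finsetSum]
    refine Finset.sum_congr rfl fun j _ => Finset.sum_congr rfl fun k hk => ?_
    have hne : X j ≠ X k := fun h => (hdisj j k (Finset.mem_Ioi.1 hk).ne).ne_of_mem (hX j) (hX k) h
    simp [rVE, hWdef, sub_ne_zero.2 hne]
  refine iInf_le_of_le X ?_
  rw [rJel, hpair, ← EReal.coe_sub, ← EReal.coe_add, EReal.coe_le_coe_iff]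
  change _ - (∑ j, ∫ y in Ω, W (X j) y) + 1 / 2 * ∫ x in Ω, ∫ y in Ω, W x y ≤ _
  have hsum := sum_sum_eq_two_mul_sum_Ioi_add a hsymm
  have hdsum : ∑ j, a j j = N * ∫ x in unitCube d, ∫ y in unitCube d, W x y := by
    simp [hdiag]
  rw [hΩΩ]
  simp only [hΩx]
  change _ ≤ (∑ j, ∑ k ∈ Finset.Ioi j, a j k) - ∑ j, ∑ k, a j k at hle
  linarith

end
end
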